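/- arXiv:2204.03603 — 10 statements merged into one kernel-verified Lean document; each statement's English description precedes it below -/
import Mathlib

section
/- If the Runge-Kutta scheme has weak stage order at least q (q ≥ 1 an integer), then dim(Y) + dim(K_q) ≤ s. -/
open Matrix Polynomial

noncomputable section

/-- The all-ones vector `e = (1,...,1)ᵀ ∈ ℝˢ`. -/
def ones (s : ℕ) : Fin s → ℝ := fun _ => 1

/-- The abscissa vector `c := A·e`. -/
def cvec {s : ℕ} (A : Matrix (Fin s) (Fin s) ℝ) : Fin s → ℝ := A.mulVec (ones s)

/-- The stage order residual `τ^(k) := A·c^{k−1} − (1/k)·c^k` (componentwise powers). -/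
def tauvec {s : ℕ} (A : Matrix (Fin s) (Fin s) ℝ) (k : ℕ) : Fin s → ℝ :=
  A.mulVec (fun i => cvec A i ^ (k - 1)) - (1 / (k : ℝ)) • fun i => cvec A i ^ k

/-- `K_m := span{ Aʲ τ^(k) : 0 ≤ j ≤ s−1, 1 ≤ k ≤ m }`. -/
def Kspace {s : ℕ} (A : Matrix (Fin s) (Fin s) ℝ) (m : ℕ) : Submodule ℝ (Fin s → ℝ) :=
  Submodule.span ℝ {v | ∃ j k : ℕ, j < s ∧ 1 ≤ k ∧ k ≤ m ∧ v = (A ^ j).mulVec (tauvec A k)}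

/-- `Y := span{ (Aᵀ)ʲ b : 0 ≤ j ≤ s−1 }`. -/
def Yspace {s : ℕ} (A : Matrix (Fin s) (Fin s) ℝ) (b : Fin s → ℝ) : Submodule ℝ (Fin s → ℝ) :=
  Submodule.span ℝ {v | ∃ j : ℕ, j < s ∧ v = (A.transpose ^ j).mulVec b}

/-- Weak stage order at least `q`: `bᵀ Aʲ τ^(k) = 0` for `0 ≤ j ≤ s−1`, `1 ≤ k ≤ q`. -/
def WSO {s : ℕ} (A : Matrix (Fin s) (Fin s) ℝ) (b : Fin s → ℝ) (q : ℕ) : Prop :=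
  ∀ j k : ℕ, j < s → 1 ≤ k → k ≤ q → b ⬝ᵥ (A ^ j).mulVec (tauvec A k) = 0

/-- `n_c`: the number of distinct abscissas, i.e. distinct entries of `c`. -/
def numAbscissas {s : ℕ} (A : Matrix (Fin s) (Fin s) ℝ) : ℕ :=
  (Finset.univ.image (cvec A)).card


/-- The scheme is stiffly accurate: the last row of `A` equals `bᵀ`. -/
def StifflyAccurate {s : ℕ} (hs : 0 < s) (A : Matrix (Fin s) (Fin s) ℝ) (b : Fin s → ℝ) : Prop :=
  ∀ j, A ⟨s - 1, Nat.sub_lt hs Nat.one_pos⟩ j = b j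

/-- A DIRK scheme: `A` is lower triangular. -/
def LowerTriangular {s : ℕ} (A : Matrix (Fin s) (Fin s) ℝ) : Prop :=
  ∀ i j : Fin s, i < j → A i j = 0

/-- A GEDIRK: `c` has a zero entry, and `a_{ℓℓ} = 0` where `ℓ` is the smallest index with `c_ℓ = 0`. -/
def GEDIRK {s : ℕ} (A : Matrix (Fin s) (Fin s) ℝ) : Prop :=
  ∃ l : Fin s, cvec A l = 0 ∧ (∀ j : Fin s, j < l → cvec A j ≠ 0) ∧ A l l = 0

/-- `QProp A b Q`: `Q` is monic, `bᵀ Q(A) = 0`, and `Q` has minimal degree among such monic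
polynomials. -/
def QProp {s : ℕ} (A : Matrix (Fin s) (Fin s) ℝ) (b : Fin s → ℝ) (Q : Polynomial ℝ) : Prop :=
  Q.Monic ∧ b ᵥ* (aeval A Q) = 0 ∧
    ∀ R : Polynomial ℝ, R.Monic → b ᵥ* (aeval A R) = 0 → Q.degree ≤ R.degree

/-- `PProp A q P`: `P` is monic, `P(A)·τ^(k) = 0` for `k = 2,…,q`, and `P` has minimal degree
among such monic polynomials. -/
def PProp {s : ℕ} (A : Matrix (Fin s) (Fin s) ℝ) (q : ℕ) (P : Polynomial ℝ) : Prop :=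
  P.Monic ∧ (∀ k : ℕ, 2 ≤ k → k ≤ q → (aeval A P).mulVec (tauvec A k) = 0) ∧
    ∀ R : Polynomial ℝ, R.Monic →
      (∀ k : ℕ, 2 ≤ k → k ≤ q → (aeval A R).mulVec (tauvec A k) = 0) → P.degree ≤ R.degree

/-- If `b` is orthogonal to `Aʲ v` for all `j` below the size of `A`, then it is orthogonal to
`Aⁿ v` for every `n`, by the Cayley–Hamilton theorem. -/
theorem dotProduct_pow_mulVec_eq_zero {R : Type*} [CommRing R] [Nontrivial R] {s : ℕ}
    {A : Matrix (Fin s) (Fin s) R} {b v : Fin s → R}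
    (h : ∀ j < s, b ⬝ᵥ (A ^ j) *ᵥ v = 0) (n : ℕ) : b ⬝ᵥ (A ^ n) *ᵥ v = 0 := by
  rw [A.pow_eq_aeval_mod_charpoly n, aeval_eq_sum_range, sum_mulVec, dotProduct_sum]
  refine Finset.sum_eq_zero fun j hj => ?_
  rw [smul_mulVec, dotProduct_smul]
  by_cases hjs : j < s
  · rw [h j hjs, smul_zero]
  · have hdeg : (X ^ n %ₘ A.charpoly).degree < (s : WithBot ℕ) := by
      simpa [A.charpoly_degree_eq_dim] using degree_modByMonic_lt (X ^ n) A.charpoly_monic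
    rw [coeff_eq_zero_of_degree_lt (hdeg.trans_le (by exact_mod_cast not_lt.mp hjs)), zero_smul]

/-- Subspaces that are orthogonal for the dot product have dimensions adding up to at most that
of the ambient space. -/
theorem finrank_add_finrank_le_of_dotProduct_eq_zero {F ι : Type*} [Field F] [Fintype ι]
    [DecidableEq ι] {Y K : Submodule F (ι → F)} (h : ∀ y ∈ Y, ∀ v ∈ K, y ⬝ᵥ v = 0) :
    Module.finrank F Y + Module.finrank F K ≤ Fintype.card ι := by
  have hle : Y.map (dotProductEquiv F ι).toLinearMap ≤ K.dualAnnihilator := by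
    rintro _ ⟨y, hy, rfl⟩
    exact (Submodule.mem_dualAnnihilator _).mpr fun v hv => h y hy v hv
  have hK := Subspace.finrank_add_finrank_dualAnnihilator_eq K
  have hY := Submodule.finrank_mono hle
  have hmap : Module.finrank F (Y.map (dotProductEquiv F ι).toLinearMap) = Module.finrank F Y :=
    LinearEquiv.finrank_map_eq (dotProductEquiv F ι) Y
  rw [Module.finrank_fintype_fun_eq_card] at hK
  omega

/-- Under weak stage order `q`, the spaces `Y` and `K_q` are orthogonal. -/
theorem WSO.dotProduct_eq_zero {s : ℕ} {A : Matrix (Fin s) (Fin s) ℝ} {b : Fin s → ℝ} {q : ℕ}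
    (hwso : WSO A b q) {y v : Fin s → ℝ} (hy : y ∈ Yspace A b) (hv : v ∈ Kspace A q) :
    y ⬝ᵥ v = 0 := by
  induction hy using Submodule.span_induction with
  | zero => exact zero_dotProduct v
  | add x y _ _ hx hy => rw [add_dotProduct, hx, hy, add_zero]
  | smul a x _ hx => rw [smul_dotProduct, hx, smul_zero]
  | mem x hx =>
    obtain ⟨i, -, rfl⟩ := hx
    induction hv using Submodule.span_induction with
    | zero => exact dotProduct_zero _
    | add x y _ _ hx hy => rw [dotProduct_add, hx, hy, add_zero]
    | smul a x _ hx => rw [dotProduct_smul, hx, smul_zero]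
    | mem x hx =>
      obtain ⟨j, k, -, hk, hkq, rfl⟩ := hx
      rw [← transpose_pow, mulVec_transpose, ← dotProduct_mulVec, mulVec_mulVec, ← pow_add]
      exact dotProduct_pow_mulVec_eq_zero (fun j hj => hwso j k hj hk hkq) (i + j)

/-- If the RK scheme has weak stage order at least `q ≥ 1`, then
`dim(Y) + dim(K_q) ≤ s`. -/
theorem dim_Y_add_dim_K_le {s : ℕ} (A : Matrix (Fin s) (Fin s) ℝ) (b : Fin s → ℝ)
    (q : ℕ) (hq : 1 ≤ q) (hwso : WSO A b q) :
    Module.finrank ℝ (Yspace A b) + Module.finrank ℝ (Kspace A q) ≤ s := by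
  simpa using finrank_add_finrank_le_of_dotProduct_eq_zero
    fun _ hy _ hv => hwso.dotProduct_eq_zero hy hv

end
end

section
/- Let A ∈ ℝ^{s×s}, let U ⊆ ℝ^s be an A-invariant subspace and V ⊆ ℝ^s an Aᵀ-invariant subspace such that U and V are orthogonal (uᵀ v = 0 for all u ∈ U, v ∈ V). Let p(x) be the monic polynomial of minimal degree with p(A)u = 0 for all u ∈ U, and let q(x) be the monic polynomial of minimal degree with q(Aᵀ)v = 0 for all v ∈ V. Then the product p(x)·q(x) divides the characteristic polynomial det(xI − A) of A. -/
open Matrix Polynomial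

noncomputable section

/-- Intertwining two endomorphisms intertwines every polynomial in them. -/
theorem aeval_apply_of_comp_eq_comp {R M N : Type*} [CommRing R] [AddCommGroup M] [Module R M]
    [AddCommGroup N] [Module R N] {f : Module.End R M} {h : Module.End R N} {g : M →ₗ[R] N}
    (hg : g ∘ₗ f = h ∘ₗ g) (r : R[X]) (x : M) : g (aeval f r x) = aeval h r (g x) := by
  induction r using Polynomial.induction_on' generalizing x with
  | add a b ha hb => simp [ha, hb]
  | monomial n c =>
    have key : ∀ x, g ((f ^ n) x) = (h ^ n) (g x) := by
      induction n with
      | zero => simp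
      | succ n ih =>
        intro x
        rw [pow_succ, pow_succ, Module.End.mul_apply, Module.End.mul_apply, ih]
        exact congrArg (h ^ n) (LinearMap.congr_fun hg x)
    simp [aeval_monomial, key]

/-- The characteristic polynomial is multiplicative along an invariant subspace. -/
theorem charpoly_eq_charpoly_restrict_mul_charpoly_mapQ {K M : Type*} [Field K] [Infinite K]
    [AddCommGroup M] [Module K M] [FiniteDimensional K M] (f : Module.End K M)
    (W : Submodule K M) (hW : W ≤ W.comap f) :
    f.charpoly = (f.restrict hW).charpoly * (W.mapQ W f hW).charpoly := by
  refine Polynomial.funext fun t => ?_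
  have ht : W ≤ W.comap (algebraMap K (Module.End K M) t - f) := fun x hx =>
    W.sub_mem (W.smul_mem t hx) (hW hx)
  rw [eval_mul, LinearMap.eval_charpoly, LinearMap.eval_charpoly, LinearMap.eval_charpoly,
    LinearMap.det_eq_det_mul_det W _ ht]
  congr 2
  ext x
  simp

/-- A monic polynomial of minimal degree among those annihilating a set of vectors divides every
polynomial annihilating that set. -/
theorem dvd_of_monic_of_minimal_annihilating {K ι : Type*} [Field K] [Fintype ι] [DecidableEq ι]
    (B : Matrix ι ι K) (S : Set (ι → K)) {p : K[X]} (hp : p.Monic)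
    (hpS : ∀ u ∈ S, aeval B p *ᵥ u = 0)
    (hmin : ∀ r : K[X], r.Monic → (∀ u ∈ S, aeval B r *ᵥ u = 0) → p.degree ≤ r.degree)
    {r : K[X]} (hr : ∀ u ∈ S, aeval B r *ᵥ u = 0) : p ∣ r := by
  rw [← modByMonic_eq_zero_iff_dvd hp]
  by_contra h0
  have hm : ∀ u ∈ S, aeval B (r %ₘ p) *ᵥ u = 0 := fun u hu => by
    rw [modByMonic_eq_sub_mul_div r p, mul_comm, map_sub, map_mul, sub_mulVec,
      ← mulVec_mulVec, hr u hu, hpS u hu, mulVec_zero, sub_zero]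
  have hle := hmin _ (monic_mul_leadingCoeff_inv h0) fun u hu => by
    rw [mul_comm, map_mul, ← mulVec_mulVec, hm u hu, mulVec_zero]
  rw [degree_mul_leadingCoeff_inv _ h0] at hle
  exact (degree_modByMonic_lt r hp).not_ge hle

theorem transpose_aeval {K ι : Type*} [Field K] [Fintype ι] [DecidableEq ι]
    (B : Matrix ι ι K) (r : K[X]) : (aeval B r)ᵀ = aeval Bᵀ r := by
  induction r using Polynomial.induction_on' with
  | add a b ha hb => simp [ha, hb]
  | monomial n c => simp [aeval_monomial, ← Algebra.smul_def, transpose_pow]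

/-- If `U` is `A`-invariant, `V` is `Aᵀ`-invariant, `U ⟂ V`, and `p`, `q` are
the monic minimal polynomials annihilating `U` (under `A`) and `V` (under `Aᵀ`) respectively,
then `p·q` divides the characteristic polynomial of `A`. -/
theorem minpoly_mul_dvd_charpoly {s : ℕ} (A : Matrix (Fin s) (Fin s) ℝ)
    (U V : Submodule ℝ (Fin s → ℝ))
    (hU : ∀ u ∈ U, A.mulVec u ∈ U) (hV : ∀ v ∈ V, A.transpose.mulVec v ∈ V)
    (hUV : ∀ u ∈ U, ∀ v ∈ V, u ⬝ᵥ v = 0)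
    (p q : Polynomial ℝ)
    (hp : p.Monic ∧ (∀ u ∈ U, (aeval A p).mulVec u = 0) ∧
      ∀ r : Polynomial ℝ, r.Monic → (∀ u ∈ U, (aeval A r).mulVec u = 0) → p.degree ≤ r.degree)
    (hq : q.Monic ∧ (∀ v ∈ V, (aeval A.transpose q).mulVec v = 0) ∧
      ∀ r : Polynomial ℝ, r.Monic → (∀ v ∈ V, (aeval A.transpose r).mulVec v = 0) →
        q.degree ≤ r.degree) :
    p * q ∣ A.charpoly := by
  obtain ⟨hpm, hpU, hpmin⟩ := hp
  obtain ⟨hqm, hqV, hqmin⟩ := hq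
  let W : Submodule ℝ (Fin s → ℝ) := V.orthogonalBilin (dotProductBilin ℝ ℝ)
  have mem_W {x : Fin s → ℝ} : x ∈ W ↔ ∀ v ∈ V, v ⬝ᵥ x = 0 := .rfl
  let f : Module.End ℝ (Fin s → ℝ) := toLinAlgEquiv' A
  have aeval_f (r : ℝ[X]) (x : Fin s → ℝ) : aeval f r x = aeval A r *ᵥ x := by
    rw [← toLinAlgEquiv'_apply, aeval_algHom_apply toLinAlgEquiv' A r]
  have hW : W ≤ W.comap f := fun x hx => mem_W.2 fun v hv => by
    rw [toLinAlgEquiv'_apply, dotProduct_mulVec, ← mulVec_transpose]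
    exact hx _ (hV v hv)
  have hUW : U ≤ W := fun u hu => mem_W.2 fun v hv => by
    rw [dotProduct_comm, hUV u hu v hv]
  have hA : A.charpoly = (f.restrict hW).charpoly * (W.mapQ W f hW).charpoly := by
    rw [← charpoly_eq_charpoly_restrict_mul_charpoly_mapQ, ← charpoly_toLin']
    rfl
  rw [hA]
  refine mul_dvd_mul
    (dvd_of_monic_of_minimal_annihilating A U hpm hpU hpmin fun u hu => ?_)
    (dvd_of_monic_of_minimal_annihilating Aᵀ V hqm hqV hqmin fun v hv => ?_)
  · have h := aeval_apply_of_comp_eq_comp (f := f.restrict hW) (h := f) (g := W.subtype) rfl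
      (f.restrict hW).charpoly ⟨u, hUW hu⟩
    rw [LinearMap.aeval_self_charpoly] at h
    rw [← aeval_f]
    exact h.symm
  · refine dotProduct_eq_zero _ fun x => ?_
    have h := aeval_apply_of_comp_eq_comp (f := f) (h := W.mapQ W f hW) (g := W.mkQ) rfl
      (W.mapQ W f hW).charpoly x
    rw [LinearMap.aeval_self_charpoly, LinearMap.zero_apply, Submodule.mkQ_apply,
      Submodule.Quotient.mk_eq_zero, aeval_f] at h
    rw [← transpose_aeval, mulVec_transpose, ← dotProduct_mulVec]
    exact h v hv

end
end

section
/- There exist polynomials N, D ∈ ℝ[z] with deg N ≤ dim Y, deg D ≤ dim Y, and D(0) = 1, such that for every z ∈ ℝ for which the matrix I − zA is invertible, one has (1 + z·bᵀ (I − zA)^{−1} e)·D(z) = N(z). (That is, the stability function R(z) = 1 + z·bᵀ(I − zA)^{−1}e is a rational function whose numerator and denominator have degree at most dim Y.) -/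
open Matrix Polynomial

noncomputable section

/-- The space `Y` is invariant under `Aᵀ`, by Cayley–Hamilton. -/
theorem Yspace_transpose_pow_mulVec_mem {s : ℕ} (A : Matrix (Fin s) (Fin s) ℝ) (b : Fin s → ℝ)
    (k : ℕ) : (A.transpose ^ k).mulVec b ∈ Yspace A b := by
  rcases Nat.eq_zero_or_pos s with rfl | hs
  · rw [Subsingleton.elim ((A.transpose ^ k).mulVec b) 0]
    exact zero_mem _
  have hdeg : (X ^ k %ₘ A.transpose.charpoly).natDegree < s := by
    have h1 : A.transpose.charpoly ≠ 1 := by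
      intro h
      have := A.transpose.charpoly_natDegree_eq_dim
      simp [h] at this
      omega
    simpa using natDegree_modByMonic_lt (X ^ k) A.transpose.charpoly_monic h1
  rw [Matrix.pow_eq_aeval_mod_charpoly, aeval_eq_sum_range, Matrix.sum_mulVec]
  refine Submodule.sum_mem _ fun j hj => ?_
  rw [Matrix.smul_mulVec]
  refine Submodule.smul_mem _ _ (Submodule.subset_span ⟨j, ?_, rfl⟩)
  rw [Finset.mem_range] at hj
  omega

theorem Yspace_mulVec_mem {s : ℕ} (A : Matrix (Fin s) (Fin s) ℝ) (b : Fin s → ℝ) :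
    ∀ v ∈ Yspace A b, A.transpose.mulVecLin v ∈ Yspace A b := by
  intro v hv
  refine Submodule.span_induction (p := fun v _ => A.transpose.mulVecLin v ∈ Yspace A b)
    ?_ ?_ ?_ ?_ hv
  · rintro _ ⟨j, -, rfl⟩
    rw [Matrix.mulVecLin_apply, Matrix.mulVec_mulVec, ← pow_succ']
    exact Yspace_transpose_pow_mulVec_mem A b (j + 1)
  · simp
  · intro x y _ _ hx hy
    rw [map_add]
    exact add_mem hx hy
  · intro a x _ hx
    rw [map_smul]
    exact Submodule.smul_mem _ a hx

/-- A monic polynomial of degree `dim Y` in `Aᵀ` annihilates `b`. -/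
theorem exists_monic_annihilator {s : ℕ} (A : Matrix (Fin s) (Fin s) ℝ) (b : Fin s → ℝ) :
    ∃ P : Polynomial ℝ, P.Monic ∧ P.natDegree = Module.finrank ℝ (Yspace A b) ∧
      ∑ j ∈ Finset.range (P.natDegree + 1), P.coeff j • (A.transpose ^ j).mulVec b = 0 := by
  set T := A.transpose.mulVecLin.restrict (Yspace_mulVec_mem A b) with hT
  have hb : b ∈ Yspace A b := by simpa using Yspace_transpose_pow_mulVec_mem A b 0
  have hpow : ∀ j : ℕ, (((T ^ j) ⟨b, hb⟩ : Yspace A b) : Fin s → ℝ)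
      = (A.transpose ^ j).mulVec b := by
    intro j
    induction j with
    | zero => simp
    | succ j ih =>
      rw [pow_succ', Module.End.mul_apply, hT, LinearMap.coe_restrict_apply, ← hT, ih,
        Matrix.mulVecLin_apply, Matrix.mulVec_mulVec, ← pow_succ']
  refine ⟨T.charpoly, T.charpoly_monic, T.charpoly_natDegree, ?_⟩
  have h := congrArg (fun L : Module.End ℝ (Yspace A b) => ((L ⟨b, hb⟩ : Yspace A b) : Fin s → ℝ))
    T.aeval_self_charpoly
  simpa [aeval_eq_sum_range, LinearMap.sum_apply, hpow] using h

/-- If a monic `P` of degree `d` annihilates a sequence `m` with `m j = μ j + z * m (j + 1)`, then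
`m 0` times the reversed polynomial of `P` at `z` is a polynomial expression in `z` and `μ`. -/
theorem reverse_eval_mul_eq {d : ℕ} (p μ m : ℕ → ℝ) (z : ℝ)
    (hrec : ∀ j, m j = μ j + z * m (j + 1))
    (hann : ∑ j ∈ Finset.range (d + 1), p j * m j = 0) :
    m 0 * ∑ j ∈ Finset.range (d + 1), p j * z ^ (d - j) =
      ∑ j ∈ Finset.range (d + 1), p j * z ^ (d - j) * ∑ i ∈ Finset.range j, μ i * z ^ i := by
  have hexp : ∀ j, m 0 = ∑ i ∈ Finset.range j, μ i * z ^ i + z ^ j * m j := by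
    intro j
    induction j with
    | zero => simp
    | succ j ih =>
      rw [ih, Finset.sum_range_succ, hrec j]
      ring
  have hz : ∑ j ∈ Finset.range (d + 1), p j * z ^ (d - j) * (z ^ j * m j) = 0 := by
    rw [← mul_zero (z ^ d), ← hann, Finset.mul_sum]
    refine Finset.sum_congr rfl fun j hj => ?_
    have hd : d = (d - j) + j := by
      rw [Finset.mem_range] at hj
      omega
    calc p j * z ^ (d - j) * (z ^ j * m j) = z ^ (d - j + j) * (p j * m j) := by ring
      _ = z ^ d * (p j * m j) := by rw [← hd]
  rw [← sub_eq_zero, ← hz, Finset.mul_sum, ← Finset.sum_sub_distrib]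
  refine Finset.sum_congr rfl fun j _ => ?_
  rw [hexp j]
  ring

/-- The stability function `R(z) = 1 + z·bᵀ(I − zA)^{−1}e` is a rational
function whose numerator and denominator have degree at most `dim Y`. -/
theorem stability_function_rational {s : ℕ} (A : Matrix (Fin s) (Fin s) ℝ) (b : Fin s → ℝ) :
    ∃ N D : Polynomial ℝ,
      N.natDegree ≤ Module.finrank ℝ (Yspace A b) ∧
      D.natDegree ≤ Module.finrank ℝ (Yspace A b) ∧
      D.eval 0 = 1 ∧
      ∀ z : ℝ, IsUnit (1 - z • A) →
        (1 + z * (b ⬝ᵥ (1 - z • A)⁻¹.mulVec (ones s))) * D.eval z = N.eval z := by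
  obtain ⟨P, hP, hdeg, hann⟩ := exists_monic_annihilator A b
  rw [← hdeg]
  set d := P.natDegree with hd
  set μ : ℕ → ℝ := fun j => (A.transpose ^ j).mulVec b ⬝ᵥ ones s with hμ
  set D : Polynomial ℝ := ∑ j ∈ Finset.range (d + 1), C (P.coeff j) * X ^ (d - j) with hD
  set M : Polynomial ℝ := ∑ j ∈ Finset.range (d + 1), C (P.coeff j) * X ^ (d - j) *
    ∑ i ∈ Finset.range j, C (μ i) * X ^ i * X with hM
  have hDdeg : D.natDegree ≤ d := natDegree_sum_le_of_forall_le _ _ fun j _ =>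
    (natDegree_C_mul_X_pow_le _ _).trans (Nat.sub_le d j)
  have hMdeg : M.natDegree ≤ d := by
    refine natDegree_sum_le_of_forall_le _ _ fun j hj => ?_
    have hsum : (∑ i ∈ Finset.range j, C (μ i) * X ^ i * X).natDegree ≤ j := by
      refine natDegree_sum_le_of_forall_le _ _ fun i hi => ?_
      rw [mul_assoc, ← pow_succ]
      exact (natDegree_C_mul_X_pow_le _ _).trans (Finset.mem_range.mp hi)
    refine (natDegree_mul_le_of_le (natDegree_C_mul_X_pow_le _ _) hsum).trans ?_
    rw [Finset.mem_range] at hj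
    omega
  refine ⟨D + M, D, natDegree_add_le_of_degree_le hDdeg hMdeg, hDdeg, ?_, fun z hz => ?_⟩
  · rw [hD, eval_finsetSum, Finset.sum_range_succ, Finset.sum_eq_zero]
    · simp [hd, hP.coeff_natDegree]
    · intro j hj
      have : d - j ≠ 0 := by
        rw [Finset.mem_range] at hj
        omega
      simp [this]
  · set w := (1 - z • A)⁻¹.mulVec (ones s) with hw
    have hres : w = ones s + z • A.mulVec w := by
      have h : (1 - z • A).mulVec w = ones s := by
        rw [hw, Matrix.mulVec_mulVec,
          Matrix.mul_nonsing_inv _ ((Matrix.isUnit_iff_isUnit_det _).mp hz),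
          Matrix.one_mulVec]
      rw [Matrix.sub_mulVec, Matrix.one_mulVec, Matrix.smul_mulVec] at h
      rw [← h, sub_add_cancel]
    have hrec : ∀ j, (A.transpose ^ j).mulVec b ⬝ᵥ w =
        μ j + z * ((A.transpose ^ (j + 1)).mulVec b ⬝ᵥ w) := by
      intro j
      conv_lhs => rw [hres]
      rw [dotProduct_add, dotProduct_smul, smul_eq_mul, pow_succ', ← Matrix.mulVec_mulVec,
        Matrix.mulVec_transpose A, ← Matrix.dotProduct_mulVec]
    have hann' : ∑ j ∈ Finset.range (d + 1),
        P.coeff j * ((A.transpose ^ j).mulVec b ⬝ᵥ w) = 0 := by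
      simpa [sum_dotProduct] using congrArg (· ⬝ᵥ w) hann
    have key := reverse_eval_mul_eq P.coeff μ
      (fun j => (A.transpose ^ j).mulVec b ⬝ᵥ w) z hrec hann'
    have hDz : D.eval z = ∑ j ∈ Finset.range (d + 1), P.coeff j * z ^ (d - j) := by
      simp [hD, eval_finsetSum]
    have hMz : M.eval z = z * ∑ j ∈ Finset.range (d + 1), P.coeff j * z ^ (d - j) *
        ∑ i ∈ Finset.range j, μ i * z ^ i := by
      simp only [hM, eval_finsetSum, eval_mul, eval_C, eval_pow, eval_X, ← Finset.sum_mul]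
      rw [Finset.mul_sum]
      exact Finset.sum_congr rfl fun j _ => by ring
    rw [eval_add, hMz, ← key, ← hDz]
    simp only [pow_zero, Matrix.one_mulVec]
    ring

end
end

section
/- Suppose the Runge-Kutta scheme satisfies the tall-tree order conditions bᵀ Aʲ e = 1/(j+1)! for 0 ≤ j ≤ p−1 (equivalently, its stability function satisfies R(z) = e^z + O(z^{p+1}) as z → 0), where p ≥ 1. Then ⌊(p + 1 + σ)/2⌋ ≤ dim Y, where σ = 1 if the scheme is stiffly accurate and A is invertible, and σ = 0 otherwise. -/
open Matrix Polynomial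

noncomputable section

/-- A nonzero polynomial of degree `n` cannot annihilate the shifts `0, …, n` of the sequence
`k ↦ 1 / (k + a)!`. -/
lemma exists_sum_coeff_div_factorial_ne_zero {Q : Polynomial ℝ} (hQ : Q ≠ 0) (a : ℕ) :
    ∃ i ≤ Q.natDegree, ∑ j ∈ Finset.range (Q.natDegree + 1),
      Q.coeff j * (1 / ((i + j + a).factorial : ℝ)) ≠ 0 := by
  by_contra! h
  set n := Q.natDegree with hn
  let P : Polynomial ℝ :=
    ∑ j ∈ Finset.range (n + 1), C (Q.coeff j) * descPochhammer ℝ (n - j)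
  have hdeg : P.natDegree < n + 1 := by
    refine Nat.lt_succ_of_le (natDegree_sum_le_of_forall_le _ _ fun j _ => ?_)
    refine (natDegree_C_mul_le _ _).trans ?_
    rw [descPochhammer_natDegree]
    exact Nat.sub_le _ _
  have hroot : ∀ i : Fin (n + 1), P.eval (((i : ℕ) + n + a : ℕ) : ℝ) = 0 := by
    intro i
    have hi := congrArg (fun x => (((i + n + a : ℕ).factorial : ℕ) : ℝ) * x) (h i (by omega))
    simp only [mul_zero, Finset.mul_sum] at hi
    rw [eval_finsetSum, ← hi]
    refine Finset.sum_congr rfl fun j hj => ?_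
    rw [Finset.mem_range] at hj
    rw [eval_mul, eval_C, descPochhammer_eval_eq_descFactorial]
    have hf := Nat.factorial_mul_descFactorial (show n - j ≤ i + n + a by omega)
    rw [show i + n + a - (n - j) = i + j + a by omega] at hf
    have h0 : ((i + j + a : ℕ).factorial : ℝ) ≠ 0 := by exact_mod_cast Nat.factorial_ne_zero _
    rw [← hf]
    push_cast
    field_simp
  have hP : P = 0 := by
    refine eq_zero_of_natDegree_lt_card_of_eval_eq_zero P
      (f := fun i : Fin (n + 1) => (((i : ℕ) + n + a : ℕ) : ℝ)) ?_ hroot (by simpa using hdeg)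
    intro i j hij
    have : (i : ℕ) + n + a = j + n + a := Nat.cast_injective (R := ℝ) hij
    ext; omega
  have h0 : P.eval 0 = Q.coeff n := by
    rw [eval_finsetSum, Finset.sum_range_succ, Finset.sum_eq_zero]
    · simp
    · intro j hj
      rw [Finset.mem_range] at hj
      rw [eval_mul, descPochhammer_ne_zero_eval_zero ℝ (by omega), mul_zero]
  rw [hP, eval_zero] at h0
  exact hQ (leadingCoeff_eq_zero.mp h0.symm)

/-- If the moments `vᵀ Aᵏ e` equal `1 / (k + a)!` for `k ≤ 2 deg Q`, then `vᵀ Q(A) ≠ 0`. -/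
lemma vecMul_aeval_ne_zero {s : ℕ} {A : Matrix (Fin s) (Fin s) ℝ} {v : Fin s → ℝ} {a : ℕ}
    {Q : Polynomial ℝ} (hQ : Q ≠ 0)
    (hv : ∀ k ≤ 2 * Q.natDegree, v ⬝ᵥ (A ^ k).mulVec (ones s) = 1 / ((k + a).factorial : ℝ)) :
    v ᵥ* aeval A Q ≠ 0 := by
  intro h
  obtain ⟨i, hi, hne⟩ := exists_sum_coeff_div_factorial_ne_zero hQ a
  apply hne
  have h1 : v ⬝ᵥ (aeval A Q * A ^ i).mulVec (ones s) = 0 := by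
    rw [dotProduct_mulVec, ← vecMul_vecMul, h, zero_vecMul, zero_dotProduct]
  rw [aeval_eq_sum_range, Finset.sum_mul, sum_mulVec, dotProduct_sum] at h1
  rw [← h1]
  refine Finset.sum_congr rfl fun j hj => ?_
  rw [Finset.mem_range] at hj
  rw [smul_mul_assoc, ← pow_add, smul_mulVec, dotProduct_smul, hv _ (by omega), smul_eq_mul,
    add_comm j i]

lemma vecMul_pow_mem_Yspace {s : ℕ} (A : Matrix (Fin s) (Fin s) ℝ) (b : Fin s → ℝ) {j : ℕ}
    (hj : j ≤ Module.finrank ℝ (Yspace A b)) : b ᵥ* A ^ j ∈ Yspace A b := by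
  rcases lt_or_ge j s with h | h
  · refine Submodule.subset_span ⟨j, h, ?_⟩
    rw [← transpose_pow, mulVec_transpose]
  · have htop : Yspace A b = ⊤ := by
      apply Submodule.eq_top_of_finrank_eq
      have := Submodule.finrank_le (Yspace A b)
      rw [Module.finrank_fin_fun] at *
      omega
    rw [htop]
    trivial

/-- Some nonzero polynomial `Q` of degree at most `dim Y` satisfies `bᵀ Q(A) = 0`. -/
lemma exists_vecMul_aeval_eq_zero {s : ℕ} (A : Matrix (Fin s) (Fin s) ℝ) (b : Fin s → ℝ) :
    ∃ Q : Polynomial ℝ, Q ≠ 0 ∧ Q.natDegree ≤ Module.finrank ℝ (Yspace A b) ∧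
      b ᵥ* aeval A Q = 0 := by
  set d := Module.finrank ℝ (Yspace A b) with hd
  let w : Fin (d + 1) → Yspace A b := fun j =>
    ⟨b ᵥ* A ^ (j : ℕ), vecMul_pow_mem_Yspace A b (by omega)⟩
  have hw : ¬ LinearIndependent ℝ w := by
    intro h
    have := h.fintype_card_le_finrank
    rw [Fintype.card_fin] at this
    omega
  obtain ⟨g, hg, i, hi⟩ := Fintype.not_linearIndependent_iff.mp hw
  have hg' := congrArg Subtype.val hg
  simp only [w, AddSubmonoidClass.coe_finsetSum, SetLike.val_smul, ZeroMemClass.coe_zero] at hg'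
  refine ⟨∑ j : Fin (d + 1), C (g j) * X ^ (j : ℕ), ?_, ?_, ?_⟩
  · intro h
    apply hi
    have hc := congrArg (fun q => q.coeff i) h
    simpa [finsetSum_coeff, coeff_C_mul, coeff_X_pow, Fin.val_inj] using hc
  · refine natDegree_sum_le_of_forall_le _ _ fun j _ => ?_
    exact (natDegree_C_mul_X_pow_le _ _).trans (by omega)
  · rw [← hg', map_sum, vecMul_sum]
    refine Finset.sum_congr rfl fun j _ => ?_
    rw [map_mul, aeval_C, map_pow, aeval_X, ← Algebra.smul_def, vecMul_smul]

/-- If `bᵀ Aʲ e = 1/(j+1)!` for `0 ≤ j ≤ p−1` (`p ≥ 1`), then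
`⌊(p+1+σ)/2⌋ ≤ dim Y`, where `σ = 1` if the scheme is stiffly accurate with `A` invertible,
and `σ = 0` otherwise. -/
theorem order_bound_dim_Y {s : ℕ} (hs : 0 < s) (A : Matrix (Fin s) (Fin s) ℝ)
    (b : Fin s → ℝ) (p σ : ℕ) (hp : 1 ≤ p)
    (horder : ∀ j : ℕ, j < p → b ⬝ᵥ (A ^ j).mulVec (ones s) = 1 / (Nat.factorial (j + 1)))
    (hσ : (σ = 1 ∧ StifflyAccurate hs A b ∧ IsUnit A.det) ∨
          (σ = 0 ∧ ¬(StifflyAccurate hs A b ∧ IsUnit A.det))) :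
    (p + 1 + σ) / 2 ≤ Module.finrank ℝ (Yspace A b) := by
  obtain ⟨Q, hQ, hdeg, hzero⟩ := exists_vecMul_aeval_eq_zero A b
  by_contra! hlt
  rcases hσ with ⟨rfl, hstiff, hdet⟩ | ⟨rfl, -⟩
  · set r : Fin s := ⟨s - 1, Nat.sub_lt hs Nat.one_pos⟩
    have hb : Pi.single r 1 ᵥ* A = b := by
      rw [single_one_vecMul]
      exact funext hstiff
    refine vecMul_aeval_ne_zero (A := A) (v := Pi.single r 1) (a := 0) hQ (fun k hk => ?_) ?_
    · cases k with
      | zero => simp [ones]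
      | succ k =>
        rw [pow_succ', ← mulVec_mulVec, dotProduct_mulVec, hb]
        exact horder k (by omega)
    · apply vecMul_injective_of_isUnit ((isUnit_iff_isUnit_det A).mpr hdet)
      have hcomm : aeval A Q * A = A * aeval A Q := by
        simpa using congrArg (aeval A) (mul_comm Q X)
      change (_ ᵥ* _) ᵥ* A = 0 ᵥ* A
      rw [vecMul_vecMul, hcomm, ← vecMul_vecMul, hb, hzero, zero_vecMul]
  · exact vecMul_aeval_ne_zero (a := 1) hQ (fun k hk => horder k (by omega)) hzero

end
end

section
/- For a Runge-Kutta scheme with n_c distinct abscissas, if 1 ≤ m ≤ 2n_c − 1 then dim(K_m) ≥ max{m − n_c, 0}. -/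
open Matrix Polynomial

noncomputable section

/-- A polynomial of degree less than `2 * S.card` with a double root at every point of `S` is zero. -/
lemma eq_zero_of_double_roots (S : Finset ℝ) (P : ℝ[X]) (hdeg : P.natDegree < 2 * S.card)
    (hroot : ∀ x ∈ S, P.eval x = 0) (hder : ∀ x ∈ S, (derivative P).eval x = 0) : P = 0 := by
  by_contra hP
  have hdvd : ∏ x ∈ S, (X - C x) ^ 2 ∣ P := by
    refine Finset.prod_dvd_of_coprime ?_ fun x hx => ?_
    · intro x _ y _ hxy
      exact (isCoprime_X_sub_C_of_isUnit_sub (sub_ne_zero.mpr hxy).isUnit).pow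
    · rw [← le_rootMultiplicity_iff hP]
      exact (one_lt_rootMultiplicity_iff_isRoot hP).mpr ⟨hroot x hx, hder x hx⟩
  have hle := natDegree_le_of_dvd hdvd hP
  rw [natDegree_prod_of_monic _ _ fun x _ => (monic_X_sub_C x).pow 2] at hle
  simp at hle
  lia

/-- The antiderivative without constant term of the truncation of `p` to degree less than `m`. -/
def truncatedPrimitive (m : ℕ) (p : ℝ[X]) : ℝ[X] :=
  ∑ k ∈ Finset.range m, monomial (k + 1) (p.coeff k / ((k + 1 : ℕ) : ℝ))

lemma natDegree_truncatedPrimitive_le (m : ℕ) (p : ℝ[X]) :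
    (truncatedPrimitive m p).natDegree ≤ m :=
  natDegree_sum_le_of_forall_le _ _ fun _ hk =>
    (natDegree_monomial_le _).trans (Finset.mem_range.mp hk)

lemma derivative_truncatedPrimitive (m : ℕ) (p : ℝ[X]) (hp : p.degree < m) :
    derivative (truncatedPrimitive m p) = p := by
  have hk (k : ℕ) : derivative (monomial (k + 1) (p.coeff k / ((k + 1 : ℕ) : ℝ))) =
      monomial k (p.coeff k) := by
    rw [derivative_monomial, Nat.add_sub_cancel, div_mul_cancel₀ _ (Nat.cast_ne_zero.mpr (by lia))]
  rw [truncatedPrimitive, derivative_sum]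
  simp_rw [hk]
  ext n
  simp only [finsetSum_coeff, coeff_monomial, Finset.sum_ite_eq', Finset.mem_range]
  split_ifs with h
  · rfl
  · exact (coeff_eq_zero_of_degree_lt (hp.trans_le (by exact_mod_cast not_lt.mp h))).symm

/-- The combination of stage order residuals `τ^(1), …, τ^(m)` with the coefficients of a
polynomial. -/
def residualMap {s : ℕ} (A : Matrix (Fin s) (Fin s) ℝ) (m : ℕ) : ℝ[X] →ₗ[ℝ] (Fin s → ℝ) :=
  ∑ k ∈ Finset.range m, (lcoeff ℝ k).smulRight (tauvec A (k + 1))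

lemma residualMap_mem_Kspace {s : ℕ} (hs : 0 < s) (A : Matrix (Fin s) (Fin s) ℝ) (m : ℕ)
    (p : ℝ[X]) : residualMap A m p ∈ Kspace A m := by
  rw [residualMap, LinearMap.sum_apply]
  refine Submodule.sum_mem _ fun k hk => Submodule.smul_mem _ _ (Submodule.subset_span ?_)
  exact ⟨0, k + 1, hs, by lia, Finset.mem_range.mp hk, by simp⟩

lemma residualMap_eq {s : ℕ} (A : Matrix (Fin s) (Fin s) ℝ) (m : ℕ) (p : ℝ[X])
    (hp : p.degree < m) :
    residualMap A m p = A.mulVec (fun i => p.eval (cvec A i)) -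
      fun i => (truncatedPrimitive m p).eval (cvec A i) := by
  have heval : (fun i => p.eval (cvec A i)) =
      ∑ k ∈ Finset.range m, p.coeff k • fun i => cvec A i ^ k := by
    ext i
    simp only [Finset.sum_apply, Pi.smul_apply, smul_eq_mul]
    by_cases h0 : p = 0
    · simp [h0]
    · exact eval_eq_sum_range' ((natDegree_lt_iff_degree_lt h0).mpr hp) _
  rw [heval, Matrix.mulVec_sum, residualMap, LinearMap.sum_apply]
  ext i
  simp only [LinearMap.smulRight_apply, lcoeff_apply, Finset.sum_apply, Pi.sub_apply,
    Pi.smul_apply, tauvec, truncatedPrimitive, eval_finsetSum, eval_monomial, Matrix.mulVec_smul,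
    Nat.add_sub_cancel, smul_eq_mul, ← Finset.sum_sub_distrib]
  refine Finset.sum_congr rfl fun k _ => ?_
  ring

/-- A polynomial of degree less than `m < 2 * n_c` that vanishes at every abscissa and is sent to
zero by `residualMap` is zero. -/
lemma eq_zero_of_residualMap_eq_zero {s : ℕ} (A : Matrix (Fin s) (Fin s) ℝ) (m : ℕ)
    (hm : m < 2 * numAbscissas A) (p : ℝ[X]) (hp : p.degree < m)
    (hroot : ∀ i, p.eval (cvec A i) = 0) (hker : residualMap A m p = 0) : p = 0 := by
  rw [residualMap_eq A m p hp] at hker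
  simp only [hroot] at hker
  have hprim : truncatedPrimitive m p = 0 := by
    refine eq_zero_of_double_roots (Finset.univ.image (cvec A)) _
      ((natDegree_truncatedPrimitive_le m p).trans_lt hm) ?_ ?_
    · simp only [Finset.mem_image, Finset.mem_univ, true_and, forall_exists_index,
        forall_apply_eq_imp_iff]
      intro i
      simpa [Matrix.mulVec, dotProduct] using congrFun hker i
    · simpa [derivative_truncatedPrimitive m p hp] using hroot
  rw [← derivative_truncatedPrimitive m p hp, hprim, derivative_zero]

/-- For a scheme with `n_c` distinct abscissas, if `1 ≤ m ≤ 2n_c − 1`,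
then `dim(K_m) ≥ max{m − n_c, 0}`. -/
theorem dim_K_lower_bound {s : ℕ} (A : Matrix (Fin s) (Fin s) ℝ) (m : ℕ)
    (hm1 : 1 ≤ m) (hm2 : (m : ℤ) ≤ 2 * (numAbscissas A : ℤ) - 1) :
    m - numAbscissas A ≤ Module.finrank ℝ (Kspace A m) := by
  have hm : m < 2 * numAbscissas A := by lia
  rcases le_or_gt m (numAbscissas A) with hle | hlt
  · simp [Nat.sub_eq_zero_of_le hle]
  have hs : 0 < s := by
    rcases Nat.eq_zero_or_pos s with rfl | h
    · simp [numAbscissas] at hm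
    · exact h
  set M : ℝ[X] := ∏ x ∈ Finset.univ.image (cvec A), (X - C x) with hMdef
  have hM : M.Monic := monic_prod_X_sub_C _ _
  have hMdeg : M.degree = numAbscissas A := by
    rw [hMdef, degree_prod]
    simp [numAbscissas]
  have hMroot (i : Fin s) : M.eval (cvec A i) = 0 := by
    rw [hMdef, eval_prod]
    exact Finset.prod_eq_zero (Finset.mem_image_of_mem _ (Finset.mem_univ i)) (by simp)
  let F : degreeLT ℝ (m - numAbscissas A) →ₗ[ℝ] Kspace A m :=
    ((residualMap A m ∘ₗ LinearMap.mulLeft ℝ M).codRestrict (Kspace A m)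
      fun _ => residualMap_mem_Kspace hs A m _).domRestrict _
  have hF : Function.Injective F := by
    rw [injective_iff_map_eq_zero]
    intro q hq
    have hdeg : (M * q.1).degree < m := by
      rw [degree_mul, hMdeg]
      by_cases h0 : q.1 = 0
      · simp [h0]
      · have hqdeg := mem_degreeLT.mp q.2
        rw [degree_eq_natDegree h0] at hqdeg ⊢
        norm_cast at hqdeg ⊢
        lia
    have hMq : M * q.1 = 0 :=
      eq_zero_of_residualMap_eq_zero A m hm _ hdeg (fun i => by simp [hMroot])
        (congrArg Subtype.val hq)
    exact Subtype.ext ((mul_eq_zero.mp hMq).resolve_left hM.ne_zero)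
  have hfin := LinearMap.finrank_le_finrank_of_injective hF
  rwa [(degreeLTEquiv ℝ _).finrank_eq, Module.finrank_fin_fun] at hfin

end
end

section
/- For a Runge-Kutta scheme with n_c distinct abscissas, if m = 2n_c and every entry of c is nonzero, then span{e, c, c², ..., c^{n_c−1}} ⊆ K_m; in particular e ∈ K_m and dim(K_m) ≥ n_c. -/
open Matrix Polynomial

noncomputable section

/-- Hermite interpolation on `S ∪ {0}` with vanishing value at `0` and vanishing derivative on
`S`. -/
theorem exists_polynomial_eval_eq_of_derivative_eq_zero (S : Finset ℝ) (hS : (0 : ℝ) ∉ S)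
    (f : S → ℝ) :
    ∃ P : ℝ[X], P.natDegree < 2 * S.card + 1 ∧ P.eval 0 = 0 ∧
      (∀ x : S, (derivative P).eval (x : ℝ) = 0) ∧ ∀ x : S, P.eval (x : ℝ) = f x := by
  let L : ℝ[X] →ₗ[ℝ] ℝ × (S → ℝ) × (S → ℝ) :=
    (leval 0).prod ((LinearMap.pi fun x : S => leval (x : ℝ) ∘ₗ derivative).prod
      (LinearMap.pi fun x : S => leval (x : ℝ)))
  have hinj : Function.Injective (L.domRestrict (degreeLT ℝ (2 * S.card + 1))) := by
    rw [← LinearMap.ker_eq_bot, LinearMap.ker_eq_bot']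
    rintro ⟨P, hP⟩ h
    have h0 : P.eval 0 = 0 := congrArg Prod.fst h
    have h1 : ∀ x : S, (derivative P).eval (x : ℝ) = 0 :=
      fun x => congrFun (congrArg (fun y => y.2.1) h) x
    have h2 : ∀ x : S, P.eval (x : ℝ) = 0 :=
      fun x => congrFun (congrArg (fun y => y.2.2) h) x
    rw [Submodule.mk_eq_zero]
    by_contra hne
    have hle : 0 ::ₘ (2 • S.val) ≤ P.roots := by
      rw [Multiset.le_iff_count]
      intro a
      rw [count_roots, Multiset.count_cons, Multiset.count_nsmul]
      by_cases ha : a ∈ S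
      · have ha0 : a ≠ 0 := fun h => hS (h ▸ ha)
        rw [Multiset.count_eq_one_of_mem S.nodup ha, if_neg ha0]
        exact (one_lt_rootMultiplicity_iff_isRoot hne).2 ⟨h2 ⟨a, ha⟩, h1 ⟨a, ha⟩⟩
      · rw [Multiset.count_eq_zero_of_notMem ha]
        split_ifs with ha0
        · subst ha0
          simpa only [mul_zero, zero_add] using Nat.succ_le_of_lt ((rootMultiplicity_pos hne).2 h0)
        · simp
    have hcard := (Multiset.card_le_card hle).trans (card_roots' P)
    have hdeg := (natDegree_lt_iff_degree_lt hne).2 (mem_degreeLT.1 hP)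
    simp at hcard
    lia
  have hdim : Module.finrank ℝ (degreeLT ℝ (2 * S.card + 1)) =
      Module.finrank ℝ (ℝ × (S → ℝ) × (S → ℝ)) := by
    rw [(degreeLTEquiv ℝ (2 * S.card + 1)).finrank_eq]
    simp
    ring
  have : FiniteDimensional ℝ (degreeLT ℝ (2 * S.card + 1)) :=
    (degreeLTEquiv ℝ (2 * S.card + 1)).symm.finiteDimensional
  obtain ⟨⟨P, hP⟩, h⟩ :=
    (LinearMap.injective_iff_surjective_of_finrank_eq_finrank hdim).1 hinj (0, 0, f)
  refine ⟨P, ?_, congrArg Prod.fst h, fun x => congrFun (congrArg (fun y => y.2.1) h) x,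
    fun x => congrFun (congrArg (fun y => y.2.2) h) x⟩
  by_cases hne : P = 0
  · simp [hne]
  · exact (natDegree_lt_iff_degree_lt hne).2 (mem_degreeLT.1 hP)

theorem tauvec_mem_Kspace {s : ℕ} (A : Matrix (Fin s) (Fin s) ℝ) {m k : ℕ} (hk : 1 ≤ k)
    (hkm : k ≤ m) : tauvec A k ∈ Kspace A m := by
  rcases Nat.eq_zero_or_pos s with rfl | hs
  · rw [Subsingleton.elim (tauvec A k) 0]
    exact zero_mem _
  · exact Submodule.subset_span ⟨0, k, hs, hk, hkm, by simp⟩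

/-- The stage order residual of a polynomial `P` with `P(0) = 0` and degree at most `m`. -/
theorem mulVec_derivative_sub_mem_Kspace {s : ℕ} (A : Matrix (Fin s) (Fin s) ℝ) {m : ℕ}
    {P : ℝ[X]} (hP : P.natDegree < m + 1) (h0 : P.eval 0 = 0) :
    A.mulVec (fun i => (derivative P).eval (cvec A i)) - (fun i => P.eval (cvec A i)) ∈
      Kspace A m := by
  have key : A.mulVec (fun i => (derivative P).eval (cvec A i)) - (fun i => P.eval (cvec A i)) =
      ∑ k ∈ Finset.range (m + 1), (P.coeff k * k) • tauvec A k := by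
    have hd : (fun i => (derivative P).eval (cvec A i)) =
        ∑ k ∈ Finset.range (m + 1), (P.coeff k * k) • fun i => cvec A i ^ (k - 1) := by
      ext i
      conv_lhs => rw [P.as_sum_range' _ hP]
      simp [derivative_monomial, eval_finsetSum]
    have he : (fun i => P.eval (cvec A i)) =
        ∑ k ∈ Finset.range (m + 1), P.coeff k • fun i => cvec A i ^ k := by
      ext i
      conv_lhs => rw [P.as_sum_range' _ hP]
      simp [eval_finsetSum]
    rw [hd, he, Matrix.mulVec_sum, ← Finset.sum_sub_distrib]
    refine Finset.sum_congr rfl fun k _ => ?_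
    rcases Nat.eq_zero_or_pos k with rfl | hk
    · simp [coeff_zero_eq_eval_zero, h0]
    · have hk' : (k : ℝ) ≠ 0 := by positivity
      rw [tauvec, smul_sub, smul_smul, Matrix.mulVec_smul, mul_assoc, mul_one_div_cancel hk',
        mul_one]
  rw [key]
  refine Submodule.sum_mem _ fun k hk => ?_
  rcases Nat.eq_zero_or_pos k with rfl | hk0
  · simp
  · exact Submodule.smul_mem _ _
      (tauvec_mem_Kspace A hk0 (Nat.lt_succ_iff.1 (Finset.mem_range.1 hk)))

/-- Every function of the abscissas lies in `K_{2n_c}` when all abscissas are nonzero. -/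
theorem comp_cvec_mem_Kspace {s : ℕ} (A : Matrix (Fin s) (Fin s) ℝ) (hc : ∀ i, cvec A i ≠ 0)
    (f : Finset.univ.image (cvec A) → ℝ) :
    (fun i => f ⟨cvec A i, Finset.mem_image_of_mem _ (Finset.mem_univ i)⟩) ∈
      Kspace A (2 * numAbscissas A) := by
  obtain ⟨P, hdeg, h0, hd, hf⟩ := exists_polynomial_eval_eq_of_derivative_eq_zero
    (Finset.univ.image (cvec A)) (by simpa using hc) f
  have hmem := mulVec_derivative_sub_mem_Kspace A hdeg h0
  have hd' : (fun i => (derivative P).eval (cvec A i)) = 0 :=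
    funext fun i => hd ⟨_, Finset.mem_image_of_mem _ (Finset.mem_univ i)⟩
  rw [hd', Matrix.mulVec_zero, zero_sub, neg_mem_iff] at hmem
  simpa only [← hf, numAbscissas] using hmem

/-- If `m = 2n_c` and every abscissa is nonzero, then
`span{e, c, …, c^{n_c−1}} ⊆ K_m`; in particular `e ∈ K_m` and `dim(K_m) ≥ n_c`. -/
theorem span_subset_K_of_ne_zero {s : ℕ} (A : Matrix (Fin s) (Fin s) ℝ) (m : ℕ)
    (hm : m = 2 * numAbscissas A) (hc : ∀ i, cvec A i ≠ 0) :
    Submodule.span ℝ {v : Fin s → ℝ | ∃ j : ℕ, j < numAbscissas A ∧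
        v = fun i => cvec A i ^ j} ≤ Kspace A m ∧
      ones s ∈ Kspace A m ∧
      numAbscissas A ≤ Module.finrank ℝ (Kspace A m) := by
  subst hm
  refine ⟨Submodule.span_le.2 ?_, comp_cvec_mem_Kspace A hc fun _ => 1, ?_⟩
  · rintro v ⟨j, -, rfl⟩
    exact comp_cvec_mem_Kspace A hc fun x => (x : ℝ) ^ j
  · let g : Fin s → Finset.univ.image (cvec A) :=
      fun i => ⟨cvec A i, Finset.mem_image_of_mem _ (Finset.mem_univ i)⟩
    have hg : Function.Surjective g := by
      rintro ⟨x, hx⟩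
      obtain ⟨i, -, rfl⟩ := Finset.mem_image.1 hx
      exact ⟨i, rfl⟩
    have h := LinearMap.finrank_le_finrank_of_injective
      (f := (LinearMap.funLeft ℝ ℝ g).codRestrict (Kspace A (2 * numAbscissas A))
        (comp_cvec_mem_Kspace A hc))
      ((LinearMap.injective_codRestrict_iff _).2 (LinearMap.funLeft_injective_of_surjective ℝ ℝ g hg))
    rwa [Module.finrank_fintype_fun_eq_card, Fintype.card_coe] at h

end
end

section
/- For a Runge-Kutta scheme with n_c distinct abscissas, if m = 2n_c − 1 and at least one entry of c is zero, then span{c, c², ..., c^{n_c−1}} ⊆ K_m; in particular c ∈ K_m and dim(K_m) ≥ n_c − 1. -/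
open Matrix Polynomial

noncomputable section

/-- The antiderivative of a real polynomial with vanishing constant term. -/
def antiderivative : ℝ[X] →ₗ[ℝ] ℝ[X] :=
  Polynomial.lsum fun k => ((k : ℝ) + 1)⁻¹ • monomial (k + 1)

theorem derivative_antiderivative (p : ℝ[X]) : derivative (antiderivative p) = p := by
  have h : derivative ∘ₗ antiderivative = LinearMap.id := by
    refine Polynomial.lhom_ext' fun k => LinearMap.ext_ring ?_
    have hk : (k : ℝ) + 1 ≠ 0 := by positivity
    have hI : antiderivative (monomial k 1) = monomial (k + 1) ((k : ℝ) + 1)⁻¹ := by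
      simp [antiderivative, Polynomial.lsum_apply, smul_monomial]
    simp only [LinearMap.comp_apply, LinearMap.id_apply]
    rw [hI, derivative_monomial_succ, inv_mul_cancel₀ hk]
  exact LinearMap.congr_fun h p

theorem coeff_antiderivative_zero (p : ℝ[X]) : (antiderivative p).coeff 0 = 0 := by
  simp [antiderivative, Polynomial.lsum_apply, Polynomial.sum, coeff_monomial]

theorem coeff_antiderivative_succ (p : ℝ[X]) (k : ℕ) :
    (antiderivative p).coeff (k + 1) = p.coeff k / (k + 1) := by
  have h := coeff_derivative (antiderivative p) k
  rw [derivative_antiderivative] at h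
  rw [h, mul_div_cancel_right₀]
  positivity

theorem natDegree_antiderivative_le (p : ℝ[X]) :
    (antiderivative p).natDegree ≤ p.natDegree + 1 := by
  refine natDegree_le_iff_coeff_eq_zero.2 fun k hk => ?_
  obtain ⟨j, rfl⟩ : ∃ j, k = j + 1 := ⟨k - 1, by omega⟩
  rw [coeff_antiderivative_succ, coeff_eq_zero_of_natDegree_lt (by omega), zero_div]

theorem eval_antiderivative {p : ℝ[X]} {N : ℕ} (hp : p.natDegree < N) (x : ℝ) :
    (antiderivative p).eval x = ∑ k ∈ Finset.range N, p.coeff k / (k + 1) * x ^ (k + 1) := by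
  rw [eval_eq_sum_range' (n := N + 1)
    (Nat.lt_succ_of_le ((natDegree_antiderivative_le p).trans hp)), Finset.sum_range_succ']
  simp [coeff_antiderivative_zero, coeff_antiderivative_succ]

/-- A nonzero polynomial with at least double roots on `S` has degree at least `2 * #S`. -/
theorem two_mul_card_le_natDegree {p : ℝ[X]} (hp : p ≠ 0) {S : Finset ℝ}
    (h : ∀ x ∈ S, p.IsRoot x ∧ (derivative p).IsRoot x) : 2 * S.card ≤ p.natDegree := by
  have hle : 2 • S.val ≤ p.roots := by
    refine Multiset.le_iff_count.2 fun x => ?_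
    rw [Multiset.count_nsmul, count_roots]
    by_cases hx : x ∈ S
    · have h1 := (one_lt_rootMultiplicity_iff_isRoot hp).2 (h x hx)
      have h2 := Multiset.nodup_iff_count_le_one.1 S.nodup x
      omega
    · rw [Multiset.count_eq_zero_of_notMem (by simpa using hx)]
      simp
  have hcard := Multiset.card_le_card hle
  rw [Multiset.card_nsmul] at hcard
  exact hcard.trans (card_roots' p)

/-- If `p` vanishes at the abscissas and `deg p < m`, then the antiderivative of `p`, evaluated
at the abscissas, lies in `K_m`. -/
theorem eval_antiderivative_mem_Kspace {s : ℕ} (A : Matrix (Fin s) (Fin s) ℝ) {m : ℕ}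
    {p : ℝ[X]} (hp : p.natDegree < m) (hroot : ∀ i, p.eval (cvec A i) = 0) :
    (fun i => (antiderivative p).eval (cvec A i)) ∈ Kspace A m := by
  have h_zero : ∑ k ∈ Finset.range m, p.coeff k • (fun i => cvec A i ^ k) = 0 := by
    funext i
    simpa [eval_eq_sum_range' hp] using hroot i
  have h_eq : (fun i => (antiderivative p).eval (cvec A i)) =
      -∑ k ∈ Finset.range m, p.coeff k • tauvec A (k + 1) := by
    have hA : ∑ k ∈ Finset.range m, p.coeff k • A.mulVec (fun i => cvec A i ^ k) = 0 := by
      simp_rw [← Matrix.mulVec_smul, ← Matrix.mulVec_sum]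
      rw [h_zero, Matrix.mulVec_zero]
    simp only [tauvec, Nat.add_sub_cancel, smul_sub, Finset.sum_sub_distrib]
    rw [hA, zero_sub, neg_neg]
    funext i
    rw [eval_antiderivative hp]
    simp [div_eq_mul_inv, mul_assoc]
  rw [h_eq]
  refine Submodule.neg_mem _ (Submodule.sum_mem _ fun k hk => Submodule.smul_mem _ _ ?_)
  rw [Finset.mem_range] at hk
  rcases Nat.eq_zero_or_pos s with rfl | hs
  · rw [Subsingleton.elim (tauvec A (k + 1)) 0]
    exact Submodule.zero_mem _
  · exact Submodule.subset_span ⟨0, k + 1, hs, by omega, by omega, by simp⟩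

/-- The nodal polynomial, with the distinct abscissas as simple roots. -/
def nodalPoly {s : ℕ} (A : Matrix (Fin s) (Fin s) ℝ) : ℝ[X] :=
  ∏ x ∈ Finset.univ.image (cvec A), (X - C x)

theorem monic_nodalPoly {s : ℕ} (A : Matrix (Fin s) (Fin s) ℝ) : (nodalPoly A).Monic :=
  monic_prod_X_sub_C _ _

theorem natDegree_nodalPoly {s : ℕ} (A : Matrix (Fin s) (Fin s) ℝ) :
    (nodalPoly A).natDegree = numAbscissas A := by
  simp [nodalPoly, numAbscissas, natDegree_finsetProd_X_sub_C_eq_card]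

theorem eval_nodalPoly {s : ℕ} (A : Matrix (Fin s) (Fin s) ℝ) (i : Fin s) :
    (nodalPoly A).eval (cvec A i) = 0 := by
  rw [nodalPoly, eval_prod]
  exact Finset.prod_eq_zero (Finset.mem_image_of_mem _ (Finset.mem_univ i)) (by simp)

/-- If `c` has a zero entry, then any polynomial vanishing at `0`, evaluated at the abscissas,
lies in the span of `c, …, c^{n_c - 1}`. -/
theorem eval_mem_span_range_pow {s : ℕ} (A : Matrix (Fin s) (Fin s) ℝ)
    (hc : ∃ i, cvec A i = 0) {p : ℝ[X]} (hp : p.eval 0 = 0) :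
    (fun i => p.eval (cvec A i)) ∈ Submodule.span ℝ
      (Set.range fun (j : Fin (numAbscissas A - 1)) (i : Fin s) => cvec A i ^ (j.val + 1)) := by
  set r := p %ₘ nodalPoly A
  have hr : ∀ i, p.eval (cvec A i) = r.eval (cvec A i) := fun i => by
    conv_lhs => rw [← modByMonic_add_div p (nodalPoly A)]
    simp [eval_nodalPoly, r]
  obtain ⟨i₀, hi₀⟩ := hc
  have hpos : 0 < numAbscissas A :=
    Finset.card_pos.2 ⟨_, Finset.mem_image_of_mem _ (Finset.mem_univ i₀)⟩
  have hr0 : r.coeff 0 = 0 := by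
    rw [coeff_zero_eq_eval_zero, ← hi₀, ← hr, hi₀, hp]
  have hdeg : r.natDegree < numAbscissas A - 1 + 1 := by
    rw [Nat.sub_add_cancel hpos, ← natDegree_nodalPoly A]
    refine natDegree_modByMonic_lt p (monic_nodalPoly A) fun h => ?_
    have := natDegree_nodalPoly A
    rw [h, natDegree_one] at this
    omega
  have h_eq : (fun i => p.eval (cvec A i)) = ∑ j : Fin (numAbscissas A - 1),
      r.coeff (j.val + 1) • fun i => cvec A i ^ (j.val + 1) := by
    funext i
    rw [hr, eval_eq_sum_range' hdeg, Finset.sum_range_succ', hr0,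
      ← Fin.sum_univ_eq_sum_range fun k => r.coeff (k + 1) * cvec A i ^ (k + 1)]
    simp
  rw [h_eq]
  exact Submodule.sum_mem _ fun j _ =>
    Submodule.smul_mem _ _ (Submodule.subset_span (Set.mem_range_self j))

/-- The map sending `q` to the values at the abscissas of the antiderivative of
`nodalPoly A * q`. -/
def nodalAntiderivative {s : ℕ} (A : Matrix (Fin s) (Fin s) ℝ) (d : ℕ) :
    degreeLT ℝ d →ₗ[ℝ] (Fin s → ℝ) :=
  LinearMap.pi fun i =>
    leval (cvec A i) ∘ₗ antiderivative ∘ₗ LinearMap.mulLeft ℝ (nodalPoly A) ∘ₗ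
      (degreeLT ℝ d).subtype

theorem nodalAntiderivative_apply {s : ℕ} (A : Matrix (Fin s) (Fin s) ℝ) (d : ℕ)
    (q : degreeLT ℝ d) :
    nodalAntiderivative A d q =
      fun i => (antiderivative (nodalPoly A * q)).eval (cvec A i) :=
  rfl

theorem natDegree_nodalPoly_mul_lt {s : ℕ} (A : Matrix (Fin s) (Fin s) ℝ)
    (hpos : 0 < numAbscissas A) (q : degreeLT ℝ (numAbscissas A - 1)) :
    (nodalPoly A * (q : ℝ[X])).natDegree < 2 * numAbscissas A - 1 := by
  by_cases hq : (q : ℝ[X]) = 0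
  · simp only [hq, mul_zero, natDegree_zero]
    omega
  · have h1 := (natDegree_lt_iff_degree_lt hq).2 (mem_degreeLT.1 q.2)
    have h2 := natDegree_mul_le (p := nodalPoly A) (q := (q : ℝ[X]))
    rw [natDegree_nodalPoly] at h2
    omega

theorem nodalAntiderivative_injective {s : ℕ} (A : Matrix (Fin s) (Fin s) ℝ)
    (hpos : 0 < numAbscissas A) :
    Function.Injective (nodalAntiderivative A (numAbscissas A - 1)) := by
  refine (injective_iff_map_eq_zero _).2 fun q hq => ?_
  have hP : antiderivative (nodalPoly A * q) = 0 := by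
    by_contra hne
    have h1 : 2 * numAbscissas A ≤ (antiderivative (nodalPoly A * q)).natDegree := by
      refine two_mul_card_le_natDegree hne fun x hx => ?_
      obtain ⟨i, -, rfl⟩ := Finset.mem_image.1 hx
      refine ⟨congrFun hq i, ?_⟩
      rw [derivative_antiderivative, IsRoot, eval_mul, eval_nodalPoly, zero_mul]
    have h2 := natDegree_antiderivative_le (nodalPoly A * q)
    have h3 := natDegree_nodalPoly_mul_lt A hpos q
    omega
  have h := derivative_antiderivative (nodalPoly A * q)
  rw [hP, derivative_zero] at h
  exact Subtype.ext ((mul_eq_zero.1 h.symm).resolve_left (monic_nodalPoly A).ne_zero)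

/-- If `m = 2n_c − 1` and at least one abscissa vanishes, then
`span{c, c², …, c^{n_c−1}} ⊆ K_m`; in particular `c ∈ K_m` and `dim(K_m) ≥ n_c − 1`. -/
theorem span_subset_K_of_exists_zero {s : ℕ} (A : Matrix (Fin s) (Fin s) ℝ) (m : ℕ)
    (hm : (m : ℤ) = 2 * (numAbscissas A : ℤ) - 1) (hc : ∃ i, cvec A i = 0) :
    Submodule.span ℝ {v : Fin s → ℝ | ∃ j : ℕ, 1 ≤ j ∧ j < numAbscissas A ∧
        v = fun i => cvec A i ^ j} ≤ Kspace A m ∧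
      cvec A ∈ Kspace A m ∧
      numAbscissas A - 1 ≤ Module.finrank ℝ (Kspace A m) := by
  have hpos : 0 < numAbscissas A := by
    obtain ⟨i, -⟩ := hc
    exact Finset.card_pos.2 ⟨_, Finset.mem_image_of_mem _ (Finset.mem_univ i)⟩
  obtain rfl : m = 2 * numAbscissas A - 1 := by omega
  set T := nodalAntiderivative A (numAbscissas A - 1)
  have hTK : LinearMap.range T ≤ Kspace A (2 * numAbscissas A - 1) := by
    rintro _ ⟨q, rfl⟩
    rw [nodalAntiderivative_apply]
    exact eval_antiderivative_mem_Kspace A (natDegree_nodalPoly_mul_lt A hpos q) fun i => by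
      rw [eval_mul, eval_nodalPoly, zero_mul]
  have hrank : Module.finrank ℝ (LinearMap.range T) = numAbscissas A - 1 := by
    rw [LinearMap.finrank_range_of_inj (nodalAntiderivative_injective A hpos),
      (degreeLTEquiv ℝ _).finrank_eq, Module.finrank_fin_fun]
  have hT : LinearMap.range T = Submodule.span ℝ
      (Set.range fun (j : Fin (numAbscissas A - 1)) (i : Fin s) => cvec A i ^ (j.val + 1)) := by
    refine Submodule.eq_of_le_of_finrank_le ?_ ?_
    · rintro _ ⟨q, rfl⟩
      rw [nodalAntiderivative_apply]
      refine eval_mem_span_range_pow A hc ?_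
      rw [← coeff_zero_eq_eval_zero, coeff_antiderivative_zero]
    · rw [hrank]
      simpa [Set.finrank] using finrank_range_le_card (R := ℝ)
        fun (j : Fin (numAbscissas A - 1)) (i : Fin s) => cvec A i ^ (j.val + 1)
  have hpow : ∀ j, 1 ≤ j → j < numAbscissas A →
      (fun i => cvec A i ^ j) ∈ Kspace A (2 * numAbscissas A - 1) := fun j h1 h2 => by
    refine hTK (hT ▸ Submodule.subset_span ⟨⟨j - 1, by omega⟩, ?_⟩)
    simp only [Nat.sub_add_cancel h1]
  refine ⟨Submodule.span_le.2 ?_, ?_, hrank.symm.le.trans (Submodule.finrank_mono hTK)⟩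
  · rintro _ ⟨j, h1, h2, rfl⟩
    exact hpow j h1 h2
  · rcases Nat.lt_or_ge 1 (numAbscissas A) with h | h
    · simpa using hpow 1 le_rfl h
    · obtain ⟨i₀, hi₀⟩ := hc
      have h_zero : cvec A = 0 := funext fun i =>
        (Finset.card_le_one.1 h _ (Finset.mem_image_of_mem _ (Finset.mem_univ i)) _
          (Finset.mem_image_of_mem _ (Finset.mem_univ i₀))).trans hi₀
      rw [h_zero]
      exact Submodule.zero_mem _

end
end

section
/- Let an s-stage Runge-Kutta scheme have n_c distinct abscissas and satisfy the first-order condition bᵀ e = 1. (i) If every entry of c is nonzero, then the scheme does not have weak stage order at least 2n_c (so its weak stage order q satisfies q ≤ 2n_c − 1). (ii) If some entry of c is zero and the scheme additionally satisfies the second-order condition bᵀ c = 1/2, then the scheme does not have weak stage order at least 2n_c − 1 (so q ≤ 2n_c − 2). -/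
open Matrix Polynomial

noncomputable section

/-- A polynomial with double zeros on `S` and zeros on `R ⊇ S`, of degree less than
`#S + #R`, vanishes. -/
lemma eq_zero_of_eval_eq_zero_of_derivative_eval_eq_zero {K : Type*} [Field K] [DecidableEq K]
    {S R : Finset K} (hSR : S ⊆ R) {F : K[X]} (hF : F.degree < (S.card + R.card : ℕ))
    (hR : ∀ x ∈ R, F.eval x = 0) (hS : ∀ x ∈ S, F.derivative.eval x = 0) : F = 0 := by
  by_contra hne
  have hdvd : ∏ x ∈ R, (X - C x) ^ (if x ∈ S then 2 else 1) ∣ F := by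
    refine Finset.prod_dvd_of_coprime ?_ ?_
    · intro x _ y _ hxy
      exact (isCoprime_X_sub_C_of_isUnit_sub (sub_ne_zero.2 hxy).isUnit).pow
    · intro x hx
      rw [← le_rootMultiplicity_iff hne]
      split_ifs with hxS
      · exact (one_lt_rootMultiplicity_iff_isRoot hne).2 ⟨hR x hx, hS x hxS⟩
      · exact (rootMultiplicity_pos hne).2 (hR x hx)
  have hdeg := natDegree_le_of_dvd hdvd hne
  rw [natDegree_prod_of_monic _ _ fun x _ => (monic_X_sub_C x).pow _] at hdeg
  have hsum : ∑ x ∈ R, (if x ∈ S then 2 else 1) = S.card + R.card := by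
    have hsplit : ∀ x ∈ R, (if x ∈ S then 2 else 1) = (if x ∈ S then 1 else 0) + 1 := by
      intro x _
      split_ifs <;> rfl
    rw [Finset.sum_congr rfl hsplit, Finset.sum_add_distrib, Finset.sum_ite_mem,
      Finset.inter_eq_right.2 hSR]
    simp
  simp only [natDegree_pow, natDegree_X_sub_C, mul_one, hsum] at hdeg
  exact absurd ((natDegree_lt_iff_degree_lt hne).2 hF) (not_lt.2 hdeg)

/-- Hermite interpolation: values on `R` and derivatives on `S ⊆ R` can be prescribed by a
polynomial of degree less than `#S + #R`. -/
lemma exists_hermite_interpolant {K : Type*} [Field K] [DecidableEq K]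
    {S R : Finset K} (hSR : S ⊆ R) (φ ψ : K → K) :
    ∃ F : K[X], F.degree < (S.card + R.card : ℕ) ∧ (∀ x ∈ R, F.eval x = φ x) ∧
      ∀ x ∈ S, F.derivative.eval x = ψ x := by
  let T : K[X] →ₗ[K] (R → K) × (S → K) :=
    (LinearMap.pi fun x : R => leval (x : K)).prod
      (LinearMap.pi fun x : S => (leval (x : K)).comp derivative)
  let L := T.domRestrict (degreeLT K (S.card + R.card))
  have hinj : Function.Injective L := by
    rw [← LinearMap.ker_eq_bot, LinearMap.ker_eq_bot']
    rintro ⟨F, hF⟩ hFL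
    have h1 := congrArg Prod.fst hFL
    have h2 := congrArg Prod.snd hFL
    exact Subtype.ext <| eq_zero_of_eval_eq_zero_of_derivative_eval_eq_zero hSR
      (mem_degreeLT.1 hF) (fun x hx => congrFun h1 ⟨x, hx⟩) fun x hx => congrFun h2 ⟨x, hx⟩
  have : FiniteDimensional K (degreeLT K (S.card + R.card)) :=
    (degreeLTEquiv K _).symm.finiteDimensional
  have hdim : Module.finrank K (degreeLT K (S.card + R.card)) =
      Module.finrank K ((R → K) × (S → K)) := by
    rw [(degreeLTEquiv K _).finrank_eq]
    simp [add_comm]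
  obtain ⟨⟨F, hF⟩, hFL⟩ := (LinearMap.injective_iff_surjective_of_finrank_eq_finrank hdim).1 hinj
    (fun x => φ x, fun x => ψ x)
  have h1 := congrArg Prod.fst hFL
  have h2 := congrArg Prod.snd hFL
  exact ⟨F, mem_degreeLT.1 hF, fun x hx => congrFun h1 ⟨x, hx⟩, fun x hx => congrFun h2 ⟨x, hx⟩⟩

/-- Under weak stage order `q`, the quadrature `b` sees the fundamental theorem of calculus
`F(c) = F(0) e + A F'(c)` for polynomials of degree at most `q`. -/
lemma WSO.dotProduct_eval {s : ℕ} {A : Matrix (Fin s) (Fin s) ℝ} {b : Fin s → ℝ} {q : ℕ}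
    (hs : 0 < s) (h : WSO A b q) (F : ℝ[X]) (hF : F.natDegree ≤ q) :
    b ⬝ᵥ (fun i => F.eval (cvec A i)) =
      F.coeff 0 * (b ⬝ᵥ ones s) + b ⬝ᵥ A *ᵥ (fun i => F.derivative.eval (cvec A i)) := by
  refine induction_with_natDegree_le (fun F : ℝ[X] => b ⬝ᵥ (fun i => F.eval (cvec A i)) =
    F.coeff 0 * (b ⬝ᵥ ones s) + b ⬝ᵥ A *ᵥ (fun i => F.derivative.eval (cvec A i)))
    q ?_ ?_ ?_ F hF
  · simp [dotProduct, mulVec]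
  · intro n a _ hn
    rcases n with _ | k
    · simp [dotProduct, mulVec, ones, Finset.mul_sum, mul_comm]
    · have hτ := h 0 (k + 1) hs (by omega) hn
      have hk : ((k : ℝ) + 1) ≠ 0 := by positivity
      simp only [pow_zero, one_mulVec, tauvec, dotProduct_sub, dotProduct_smul, smul_eq_mul,
        Nat.add_sub_cancel] at hτ
      have hval : (fun i => (C a * X ^ (k + 1) : ℝ[X]).eval (cvec A i)) =
          a • fun i => cvec A i ^ (k + 1) := by
        ext i
        simp
      have hder : (fun i => (derivative (C a * X ^ (k + 1) : ℝ[X])).eval (cvec A i)) =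
          (a * (k + 1)) • fun i => cvec A i ^ k := by
        ext i
        simp [mul_assoc]
      rw [hval, hder, mulVec_smul, dotProduct_smul, dotProduct_smul, smul_eq_mul, smul_eq_mul]
      push_cast at hτ
      have hcoeff : (C a * X ^ (k + 1) : ℝ[X]).coeff 0 = 0 := by simp
      rw [hcoeff, sub_eq_zero.1 hτ]
      field_simp
      ring
  · intro f g _ _ hf hg
    have hval : (fun i => (f + g).eval (cvec A i)) =
        (fun i => f.eval (cvec A i)) + fun i => g.eval (cvec A i) := by
      ext i
      simp
    have hder : (fun i => (derivative (f + g)).eval (cvec A i)) =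
        (fun i => f.derivative.eval (cvec A i)) + fun i => g.derivative.eval (cvec A i) := by
      ext i
      simp
    rw [hval, hder, mulVec_add, dotProduct_add, dotProduct_add, coeff_add, hf, hg]
    ring

/-- If the weak stage order is at least `n_c + #(nonzero abscissas)`, then `b` annihilates every
function of the abscissas that vanishes at `0`. -/
lemma WSO.dotProduct_comp_eq_zero {s : ℕ} {A : Matrix (Fin s) (Fin s) ℝ} {b : Fin s → ℝ} {q : ℕ}
    (hs : 0 < s) (h : WSO A b q)
    (hq : numAbscissas A + (insert 0 (Finset.univ.image (cvec A))).card ≤ q + 1)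
    {φ : ℝ → ℝ} (hφ : φ 0 = 0) : b ⬝ᵥ (fun i => φ (cvec A i)) = 0 := by
  obtain ⟨F, hdeg, hval, hder⟩ := exists_hermite_interpolant
    (Finset.subset_insert 0 (Finset.univ.image (cvec A))) φ 0
  have hmem : ∀ i, cvec A i ∈ Finset.univ.image (cvec A) :=
    fun i => Finset.mem_image_of_mem _ (Finset.mem_univ i)
  have hnat : F.natDegree ≤ q := by
    refine natDegree_le_iff_coeff_eq_zero.2 fun N hN => (degree_lt_iff_coeff_zero _ _).1 hdeg N ?_
    exact hq.trans hN
  have key := h.dotProduct_eval hs F hnat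
  have h0 : F.coeff 0 = 0 := by
    rw [coeff_zero_eq_eval_zero, hval 0 (Finset.mem_insert_self _ _), hφ]
  have hd : (fun i => F.derivative.eval (cvec A i)) = 0 := funext fun i => hder _ (hmem i)
  have hv : (fun i => F.eval (cvec A i)) = fun i => φ (cvec A i) :=
    funext fun i => hval _ (Finset.mem_insert_of_mem (hmem i))
  rwa [h0, hd, hv, mulVec_zero, dotProduct_zero, zero_mul, add_zero] at key

/-- Let an `s`-stage scheme satisfy `bᵀe = 1`.
(i) If every abscissa is nonzero, then its weak stage order is `≤ 2n_c − 1`.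
(ii) If some abscissa vanishes and additionally `bᵀc = 1/2`, then its weak stage order is
`≤ 2n_c − 2`. -/
theorem wso_upper_bound_from_abscissas {s : ℕ} (A : Matrix (Fin s) (Fin s) ℝ)
    (b : Fin s → ℝ) (hb : b ⬝ᵥ ones s = 1) :
    ((∀ i, cvec A i ≠ 0) → ¬ WSO A b (2 * numAbscissas A)) ∧
    ((∃ i, cvec A i = 0) → b ⬝ᵥ cvec A = 1 / 2 →
      ¬ WSO A b (2 * numAbscissas A - 1)) := by
  have hs : 0 < s := by
    rcases Nat.eq_zero_or_pos s with rfl | hs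
    · simp [dotProduct] at hb
    · exact hs
  constructor
  · intro hc h
    have hq : numAbscissas A + (insert 0 (Finset.univ.image (cvec A))).card ≤
        2 * numAbscissas A + 1 := by
      have := Finset.card_insert_le 0 (Finset.univ.image (cvec A))
      simp only [numAbscissas]
      omega
    have hzero := h.dotProduct_comp_eq_zero hs hq (φ := fun x => if x = 0 then 0 else 1)
      (if_pos rfl)
    have hone : (fun i => if cvec A i = 0 then (0 : ℝ) else 1) = ones s :=
      funext fun i => if_neg (hc i)
    rw [hone, hb] at hzero
    exact one_ne_zero hzero
  · rintro ⟨i, hi⟩ hbc h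
    have hmem : (0 : ℝ) ∈ Finset.univ.image (cvec A) :=
      Finset.mem_image.2 ⟨i, Finset.mem_univ i, hi⟩
    have hq : numAbscissas A + (insert 0 (Finset.univ.image (cvec A))).card ≤
        2 * numAbscissas A - 1 + 1 := by
      rw [Finset.insert_eq_of_mem hmem]
      simp only [numAbscissas]
      omega
    have hzero : b ⬝ᵥ cvec A = 0 := h.dotProduct_comp_eq_zero hs hq (φ := id) rfl
    rw [hbc] at hzero
    norm_num at hzero

end
end

section
/- Let an s-stage Runge-Kutta scheme with n_c distinct abscissas have weak stage order at least q, where 1 ≤ q ≤ 2n_c − 1, and satisfy bᵀ Aʲ e = 1/(j+1)! for 0 ≤ j ≤ p−1 (p ≥ 1). Then q + ⌊(p + 1 + σ)/2⌋ ≤ s + n_c, where σ = 1 if the scheme is stiffly accurate and A is invertible, and σ = 0 otherwise. -/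
open Matrix Polynomial

noncomputable section

/-- The matrix with entries `1 / (i + j + a)!` is nonsingular. -/
theorem det_inv_factorial_ne_zero (d a : ℕ) :
    (Matrix.of fun m i : Fin d => (1 : ℝ) / ((i + m + a : ℕ).factorial : ℝ)).det ≠ 0 := by
  set N : Fin d → ℕ := fun m => m + (d - 1) + a with hN
  set D : Matrix (Fin d) (Fin d) ℝ :=
    Matrix.of fun m i => (descPochhammer ℝ i).eval (N m : ℝ) with hD
  have hdet : D.det ≠ 0 := by
    rw [hD, ← Matrix.det_eval_matrixOfPolynomials_eq_det_vandermonde (fun m => (N m : ℝ))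
      (fun i : Fin d => descPochhammer ℝ i) (fun i => descPochhammer_natDegree ℝ i)
      (fun i => monic_descPochhammer ℝ i), Matrix.det_vandermonde_ne_zero_iff]
    intro x y hxy
    have : N x = N y := Nat.cast_injective (R := ℝ) hxy
    ext
    simp only [hN] at this
    omega
  have hmul : D = Matrix.of fun m i : Fin d => ((N m).factorial : ℝ) *
      ((Matrix.of fun m i : Fin d => (1 : ℝ) / ((i + m + a : ℕ).factorial : ℝ)).submatrix id
        Fin.revPerm) m i := by
    ext m i
    have hi := i.isLt
    have hle : (i : ℕ) ≤ N m := by simp only [hN]; omega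
    have hsub : (Fin.rev i : ℕ) + m + a = N m - i := by
      simp only [hN, Fin.val_rev]; omega
    simp only [hD, Matrix.of_apply, Matrix.submatrix_apply, id, Fin.revPerm_apply, hsub]
    rw [descPochhammer_eval_eq_descFactorial, mul_one_div, eq_div_iff (by positivity), mul_comm]
    exact_mod_cast Nat.factorial_mul_descFactorial hle
  intro h0
  apply hdet
  rw [hmul, Matrix.det_mul_column, Matrix.det_permute', h0, mul_zero, mul_zero]

/-- If the moments `b ⬝ᵥ Aᵏ u` for `k ≤ 2d - 2` are `1 / (k + a)!`, then the row vectors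
`bᵀ Aʲ`, `j < d`, are linearly independent. -/
theorem linearIndependent_vecMul_pow {s d a : ℕ} {A : Matrix (Fin s) (Fin s) ℝ}
    {b u : Fin s → ℝ}
    (hu : ∀ k : ℕ, k + 2 ≤ 2 * d → b ⬝ᵥ (A ^ k) *ᵥ u = 1 / ((k + a).factorial : ℝ)) :
    LinearIndependent ℝ fun j : Fin d => b ᵥ* A ^ (j : ℕ) := by
  rw [Fintype.linearIndependent_iff]
  intro x hx
  refine fun i => congrFun (Matrix.eq_zero_of_mulVec_eq_zero (det_inv_factorial_ne_zero d a) ?_) i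
  ext m
  have h := congrArg (fun v => v ⬝ᵥ (A ^ (m : ℕ)) *ᵥ u) hx
  simp only [sum_dotProduct, smul_dotProduct, zero_dotProduct, ← dotProduct_mulVec, mulVec_mulVec,
    ← pow_add] at h
  rw [Pi.zero_apply, ← h, mulVec, dotProduct]
  refine Finset.sum_congr rfl fun i _ => ?_
  rw [hu _ (by omega), Matrix.of_apply, smul_eq_mul, mul_comm]

/-- A polynomial vanishing to second order at every point of `t` and of degree less than
`2 * #t` is zero. -/
theorem Polynomial.eq_zero_of_eval_derivative_eq_zero {t : Finset ℝ} {F : ℝ[X]}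
    (hdeg : F.degree < (2 * t.card : ℕ)) (h0 : ∀ x ∈ t, F.eval x = 0)
    (h1 : ∀ x ∈ t, (derivative F).eval x = 0) : F = 0 := by
  by_contra hF
  have hdvd : ∏ x ∈ t, (X - C x) ^ 2 ∣ F := by
    refine Finset.prod_dvd_of_coprime (fun x _ y _ hxy => ?_) fun x hx => ?_
    · exact (pairwise_coprime_X_sub_C Function.injective_id hxy).pow
    · rw [← le_rootMultiplicity_iff hF]
      exact (one_lt_rootMultiplicity_iff_isRoot hF).2 ⟨h0 x hx, h1 x hx⟩
  have hle := degree_le_of_dvd hdvd hF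
  rw [degree_prod, Finset.sum_congr rfl fun x _ => by rw [degree_pow, degree_X_sub_C]] at hle
  refine absurd hdeg (not_lt.2 (le_trans (le_of_eq ?_) hle))
  simp [mul_comm]

/-- The linear map `F ↦ A F'(c) - F(c) + F(0) e`, which sends `Xᵏ` to `k τ⁽ᵏ⁾`. -/
def stageResidual {s : ℕ} (A : Matrix (Fin s) (Fin s) ℝ) : ℝ[X] →ₗ[ℝ] (Fin s → ℝ) where
  toFun F := A *ᵥ (fun i => (derivative F).eval (cvec A i)) - (fun i => F.eval (cvec A i)) +
    F.eval 0 • ones s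
  map_add' F G := by
    have h : (fun i => (derivative (F + G)).eval (cvec A i)) =
        (fun i => (derivative F).eval (cvec A i)) + fun i => (derivative G).eval (cvec A i) := by
      ext i; simp
    rw [h, mulVec_add]
    ext i
    simp
    ring
  map_smul' r F := by
    have h : (fun i => (derivative (r • F)).eval (cvec A i)) =
        r • fun i => (derivative F).eval (cvec A i) := by
      ext i; simp
    rw [h, mulVec_smul]
    ext i
    simp
    ring

theorem stageResidual_apply {s : ℕ} (A : Matrix (Fin s) (Fin s) ℝ) (F : ℝ[X]) :
    stageResidual A F = A *ᵥ (fun i => (derivative F).eval (cvec A i)) -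
      (fun i => F.eval (cvec A i)) + F.eval 0 • ones s :=
  rfl

theorem stageResidual_one {s : ℕ} (A : Matrix (Fin s) (Fin s) ℝ) : stageResidual A 1 = 0 := by
  ext i
  simp [stageResidual_apply, ones, mulVec, dotProduct]

theorem stageResidual_X_pow {s : ℕ} (A : Matrix (Fin s) (Fin s) ℝ) {k : ℕ} (hk : k ≠ 0) :
    stageResidual A (X ^ k) = (k : ℝ) • tauvec A k := by
  have h : (fun i => (derivative (X ^ k : ℝ[X])).eval (cvec A i)) =
      (k : ℝ) • fun i => cvec A i ^ (k - 1) := by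
    ext i; simp [derivative_X_pow]
  have hk' : (k : ℝ) ≠ 0 := by exact_mod_cast hk
  rw [stageResidual_apply, h, mulVec_smul, tauvec, smul_sub, smul_smul, mul_one_div_cancel hk']
  ext i
  simp [hk]

theorem WSO.dotProduct_stageResidual {s q : ℕ} {A : Matrix (Fin s) (Fin s) ℝ} {b : Fin s → ℝ}
    (h : WSO A b q) {j : ℕ} (hj : j < s) {F : ℝ[X]} (hF : F ∈ degreeLT ℝ (q + 1)) :
    b ᵥ* A ^ j ⬝ᵥ stageResidual A F = 0 := by
  rw [degreeLT_succ_eq_degreeLE, mem_degreeLE, ← natDegree_le_iff_degree_le] at hF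
  rw [F.as_sum_range' (q + 1) (Nat.lt_succ_of_le hF), map_sum, dotProduct_sum]
  refine Finset.sum_eq_zero fun k hk => ?_
  rw [← C_mul_X_pow_eq_monomial, ← smul_eq_C_mul, map_smul, dotProduct_smul]
  rcases Nat.eq_zero_or_pos k with rfl | hk0
  · rw [pow_zero, stageResidual_one, dotProduct_zero, smul_zero]
  · rw [stageResidual_X_pow A hk0.ne', dotProduct_smul, ← dotProduct_mulVec,
      h j k hj hk0 (Nat.lt_succ_iff.1 (Finset.mem_range.1 hk)), smul_zero, smul_zero]

/-- Independence of `bᵀ Aʲ`, `j < d`, bounds the weak stage order: the residuals lie in an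
`(s - d)`-dimensional space, and `F` of degree at most `q` is determined by its residual, by `F(0)`
and by the values of `F'` at the abscissas. -/
theorem WSO.add_le_of_linearIndependent {s q d : ℕ} {A : Matrix (Fin s) (Fin s) ℝ}
    {b : Fin s → ℝ} (h : WSO A b q) (hq : q < 2 * numAbscissas A)
    (hd : LinearIndependent ℝ fun j : Fin d => b ᵥ* A ^ (j : ℕ)) :
    q + d ≤ s + numAbscissas A := by
  have hds : d ≤ s := by simpa using hd.fintype_card_le_finrank
  set t := Finset.univ.image (cvec A) with ht
  have hct : ∀ i, cvec A i ∈ t := fun i => Finset.mem_image_of_mem _ (Finset.mem_univ i)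
  set M : Matrix (Fin d) (Fin s) ℝ := Matrix.of fun j => b ᵥ* A ^ (j : ℕ) with hM
  have hrank : Module.finrank ℝ M.mulVecLin.range = d := by
    simpa [Matrix.rank] using LinearIndependent.rank_matrix (M := M) hd
  have hker := M.mulVecLin.finrank_range_add_finrank_ker
  rw [hrank, Module.finrank_fin_fun] at hker
  let S : degreeLT ℝ (q + 1) →ₗ[ℝ] M.mulVecLin.ker :=
    ((stageResidual A).domRestrict _).codRestrict _ fun F => by
      rw [LinearMap.mem_ker]
      ext j
      exact h.dotProduct_stageResidual (j.isLt.trans_le hds) F.2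
  let E : degreeLT ℝ (q + 1) →ₗ[ℝ] ℝ × (t → ℝ) :=
    ((leval 0).prod (LinearMap.pi fun x : t => (leval (x : ℝ)).comp derivative)).domRestrict _
  have hinj : Function.Injective (S.prod E) := by
    rw [← LinearMap.ker_eq_bot, LinearMap.ker_eq_bot']
    rintro ⟨F, hF⟩ h0
    have hS : stageResidual A F = 0 := congrArg (fun v => (v.1 : Fin s → ℝ)) h0
    have hF0 : F.eval 0 = 0 := congrArg (fun v => v.2.1) h0
    have hF1 : ∀ x ∈ t, (derivative F).eval x = 0 := fun x hx =>
      congrFun (congrArg (fun v => v.2.2) h0) ⟨x, hx⟩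
    have hc : (fun i => (derivative F).eval (cvec A i)) = 0 := funext fun i => hF1 _ (hct i)
    rw [stageResidual_apply, hF0, hc, mulVec_zero, zero_smul, add_zero, zero_sub,
      neg_eq_zero] at hS
    refine Subtype.ext (eq_zero_of_eval_derivative_eq_zero (t := t) ?_ (fun x hx => ?_) hF1)
    · refine (mem_degreeLT.1 hF).trans_le ?_
      exact_mod_cast hq
    · obtain ⟨i, -, rfl⟩ := Finset.mem_image.1 hx
      exact congrFun hS i
  have hle := LinearMap.finrank_le_finrank_of_injective hinj
  rw [(degreeLTEquiv ℝ (q + 1)).finrank_eq, Module.finrank_prod, Module.finrank_prod,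
    Module.finrank_self, Module.finrank_fin_fun, Module.finrank_fintype_fun_eq_card,
    Fintype.card_coe] at hle
  change q + d ≤ s + t.card
  omega

/-- Main result for general RK schemes. For a scheme of order `p ≥ 1`
(tall-tree conditions) with weak stage order at least `q`, where `1 ≤ q ≤ 2n_c − 1`,
one has `q + ⌊(p+1+σ)/2⌋ ≤ s + n_c`, with `σ = 1` iff the scheme is stiffly accurate with
`A` invertible. -/
theorem main_result_general {s : ℕ} (hs : 0 < s) (A : Matrix (Fin s) (Fin s) ℝ)
    (b : Fin s → ℝ) (p q σ : ℕ) (hp : 1 ≤ p) (hq1 : 1 ≤ q)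
    (hq2 : (q : ℤ) ≤ 2 * (numAbscissas A : ℤ) - 1)
    (hwso : WSO A b q)
    (horder : ∀ j : ℕ, j < p → b ⬝ᵥ (A ^ j).mulVec (ones s) = 1 / (Nat.factorial (j + 1)))
    (hσ : (σ = 1 ∧ StifflyAccurate hs A b ∧ IsUnit A.det) ∨
          (σ = 0 ∧ ¬(StifflyAccurate hs A b ∧ IsUnit A.det))) :
    q + (p + 1 + σ) / 2 ≤ s + numAbscissas A := by
  refine hwso.add_le_of_linearIndependent (by omega) ?_
  rcases hσ with ⟨rfl, hstiff, hdet⟩ | ⟨rfl, -⟩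
  · refine linearIndependent_vecMul_pow (a := 0) (u := A⁻¹ *ᵥ ones s) fun k hk => ?_
    rw [mulVec_mulVec]
    cases k with
    | zero =>
      have hb : b = A ⟨s - 1, Nat.sub_lt hs Nat.one_pos⟩ := (funext hstiff).symm
      have h := congrArg (· *ᵥ ones s) (Matrix.mul_nonsing_inv A hdet)
      simp only [one_mulVec] at h
      rw [← mulVec_mulVec] at h
      rw [pow_zero, one_mul, hb]
      exact (congrFun h ⟨s - 1, Nat.sub_lt hs Nat.one_pos⟩).trans (by simp [ones])
    | succ k =>
      rw [pow_succ, mul_assoc, Matrix.mul_nonsing_inv A hdet, mul_one, horder k (by omega)]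
  · exact linearIndependent_vecMul_pow (a := 1) fun k hk => horder k (by omega)

end
end

section
/- Let Q ∈ ℝ[x] be the unique monic polynomial of minimal degree with bᵀ Q(A) = 0, and set d := deg Q (= dim Y). Suppose bᵀ Aʲ e = 1/(j+1)! for 0 ≤ j ≤ p−1. Writing Q = Q_d + α_{d−1} Q_{d−1} + ... + α_0 Q_0 in the basis {Q_0, ..., Q_d} (possible since Q_n is monic of degree n), the coefficients satisfy α_j = 0 for all 0 ≤ j ≤ p − d − 1. -/
open Matrix Polynomial

noncomputable section

/-- The orthogonal polynomials `Q_0(x) = 1`, `Q_1(x) = x − 1/2`,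
`Q_{n+1}(x) = x·Q_n(x) + (1/(4(4n²−1)))·Q_{n−1}(x)` for `n ≥ 1`. -/
def Qpoly : ℕ → Polynomial ℝ
  | 0 => 1
  | 1 => X - C (1 / 2)
  | (n + 2) => X * Qpoly (n + 1) + C (1 / (4 * (4 * ((n : ℝ) + 1) ^ 2 - 1))) * Qpoly n

/-- The linear functional on polynomials with moments `xʲ ↦ 1/(j+1)!`. -/
def momentFunctional : ℝ[X] →ₗ[ℝ] ℝ :=
  Polynomial.lsum fun j => (1 / ((j + 1).factorial : ℝ)) • LinearMap.id

theorem momentFunctional_eq_sum {P : ℝ[X]} {n : ℕ} (h : P.natDegree < n) :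
    momentFunctional P = ∑ i ∈ Finset.range n, P.coeff i * (1 / ((i + 1).factorial : ℝ)) := by
  change P.sum (fun j a => (1 / ((j + 1).factorial : ℝ)) * a) = _
  rw [Polynomial.sum_over_range' P (by simp) n h]
  exact Finset.sum_congr rfl fun i _ => mul_comm _ _

theorem momentFunctional_X_pow (k : ℕ) :
    momentFunctional (X ^ k) = 1 / ((k + 1).factorial : ℝ) := by
  rw [momentFunctional_eq_sum (n := k + 1) (by simp)]
  simp [coeff_X_pow]

theorem momentFunctional_C_mul (a : ℝ) (P : ℝ[X]) :
    momentFunctional (C a * P) = a * momentFunctional P := by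
  rw [← smul_eq_C_mul, map_smul, smul_eq_mul]

/-- The order conditions identify `bᵀ P(A) e` with the moment functional in low degree. -/
theorem dotProduct_aeval_mulVec_ones {s : ℕ} {A : Matrix (Fin s) (Fin s) ℝ} {b : Fin s → ℝ}
    {p : ℕ}
    (horder : ∀ j : ℕ, j < p → b ⬝ᵥ (A ^ j).mulVec (ones s) = 1 / (Nat.factorial (j + 1)))
    {P : ℝ[X]} (hP : P.natDegree < p) :
    b ⬝ᵥ (aeval A P).mulVec (ones s) = momentFunctional P := by
  rw [momentFunctional_eq_sum hP, aeval_eq_sum_range' hP, sum_mulVec, dotProduct_sum]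
  refine Finset.sum_congr rfl fun i hi => ?_
  rw [smul_mulVec, dotProduct_smul, horder i (Finset.mem_range.mp hi), smul_eq_mul]

/-- The normalizing constants in the moments of `Qpoly`. -/
def momentConst : ℕ → ℝ
  | 0 => 1
  | n + 1 => -momentConst n / (4 * n + 2)

theorem momentConst_ne_zero (n : ℕ) : momentConst n ≠ 0 := by
  induction n with
  | zero => simp [momentConst]
  | succ n ih => exact div_ne_zero (neg_ne_zero.mpr ih) (by positivity)

theorem cast_descFactorial_succ (k n : ℕ) :
    (k.descFactorial (n + 1) : ℝ) = (k - n) * k.descFactorial n := by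
  rw [Nat.descFactorial_succ]
  rcases le_or_gt n k with h | h
  · rw [Nat.cast_mul, Nat.cast_sub h]
  · simp [Nat.descFactorial_of_lt h]

theorem momentFunctional_Qpoly_mul_X_pow (n k : ℕ) :
    momentFunctional (Qpoly n * X ^ k) =
      momentConst n * k.descFactorial n / ((k + n + 1).factorial : ℝ) := by
  have hfac (m : ℕ) : ((m + 1).factorial : ℝ) = (m + 1) * m.factorial := by
    rw [Nat.factorial_succ]; push_cast; ring
  induction n using Nat.twoStepInduction generalizing k with
  | zero => simp [Qpoly, momentConst, momentFunctional_X_pow]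
  | one =>
    have h : Qpoly 1 * X ^ k = X ^ (k + 1) - C (1 / 2) * X ^ k := by
      simp only [Qpoly]; ring
    have hk : ((k + 1).factorial : ℝ) ≠ 0 := by positivity
    have hk2 : (k : ℝ) + 1 + 1 ≠ 0 := by positivity
    rw [h, map_sub, momentFunctional_C_mul, momentFunctional_X_pow, momentFunctional_X_pow,
      hfac (k + 1)]
    simp only [momentConst, Nat.descFactorial_one]
    push_cast
    field_simp
    ring
  | more n ih₀ ih₁ =>
    have h : Qpoly (n + 2) * X ^ k = Qpoly (n + 1) * X ^ (k + 1) +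
        C (1 / (4 * (4 * ((n : ℝ) + 1) ^ 2 - 1))) * (Qpoly n * X ^ k) := by
      simp only [Qpoly]; ring
    have hf : ((k + n + 1).factorial : ℝ) ≠ 0 := by positivity
    have h₁ : (k : ℝ) + n + 1 + 1 ≠ 0 := by positivity
    have h₂ : (k : ℝ) + n + 1 + 1 + 1 ≠ 0 := by positivity
    have h₃ : 4 * (n : ℝ) + 2 ≠ 0 := by positivity
    have h₄ : 4 * ((n : ℝ) + 1) + 2 ≠ 0 := by positivity
    have h₅ : 4 * (4 * ((n : ℝ) + 1) ^ 2 - 1) = (4 * n + 2) * (4 * (n + 1) + 2) := by ring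
    rw [h, map_add, momentFunctional_C_mul, ih₀, ih₁, Nat.succ_descFactorial_succ,
      cast_descFactorial_succ, cast_descFactorial_succ, h₅,
      show k + 1 + (n + 1) + 1 = k + n + 1 + 1 + 1 by ring,
      show k + (n + 2) + 1 = k + n + 1 + 1 + 1 by ring, hfac, hfac]
    simp only [momentConst]
    push_cast
    field_simp
    ring

theorem natDegree_Qpoly_le (n : ℕ) : (Qpoly n).natDegree ≤ n := by
  induction n using Nat.twoStepInduction with
  | zero => simp [Qpoly]
  | one => simp only [Qpoly]; compute_degree
  | more n ih₀ ih₁ =>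
    refine natDegree_add_le_of_degree_le ?_ ?_
    · exact natDegree_mul_le.trans (by rw [natDegree_X]; omega)
    · exact (natDegree_C_mul_le _ _).trans (by omega)

theorem coeff_Qpoly_self (n : ℕ) : (Qpoly n).coeff n = 1 := by
  induction n using Nat.twoStepInduction with
  | zero => simp [Qpoly]
  | one => simp [Qpoly]
  | more n _ ih₁ =>
    have h : (Qpoly n).coeff (n + 2) = 0 :=
      coeff_eq_zero_of_natDegree_lt ((natDegree_Qpoly_le n).trans_lt (by omega))
    rw [Qpoly, coeff_add, coeff_X_mul, coeff_C_mul, ih₁, h, mul_zero, add_zero]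

/-- In degree at most `n`, only the `n`-th coefficient is seen by pairing with `Qpoly n`. -/
theorem momentFunctional_Qpoly_mul {n : ℕ} {P : ℝ[X]} (hP : P.natDegree ≤ n) :
    momentFunctional (Qpoly n * P) =
      P.coeff n * (momentConst n * n.factorial / ((n + n + 1).factorial : ℝ)) := by
  conv_lhs => rw [P.as_sum_range_C_mul_X_pow' (Nat.lt_succ_of_le hP)]
  rw [Finset.mul_sum, map_sum, Finset.sum_range_succ, Finset.sum_eq_zero, zero_add]
  · rw [mul_left_comm, momentFunctional_C_mul, momentFunctional_Qpoly_mul_X_pow,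
      Nat.descFactorial_self]
  · intro i hi
    rw [mul_left_comm, momentFunctional_C_mul, momentFunctional_Qpoly_mul_X_pow,
      Nat.descFactorial_of_lt (Finset.mem_range.mp hi)]
    simp

theorem momentFunctional_Qpoly_mul_Qpoly_of_lt {m n : ℕ} (h : m < n) :
    momentFunctional (Qpoly n * Qpoly m) = 0 := by
  have hm := (natDegree_Qpoly_le m).trans_lt h
  rw [momentFunctional_Qpoly_mul hm.le, coeff_eq_zero_of_natDegree_lt hm, zero_mul]

theorem momentFunctional_Qpoly_mul_Qpoly_of_ne {m n : ℕ} (h : m ≠ n) :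
    momentFunctional (Qpoly n * Qpoly m) = 0 := by
  rcases h.lt_or_gt with h | h
  · exact momentFunctional_Qpoly_mul_Qpoly_of_lt h
  · rw [mul_comm]
    exact momentFunctional_Qpoly_mul_Qpoly_of_lt h

theorem momentFunctional_Qpoly_mul_self_ne_zero (n : ℕ) :
    momentFunctional (Qpoly n * Qpoly n) ≠ 0 := by
  rw [momentFunctional_Qpoly_mul (natDegree_Qpoly_le n), coeff_Qpoly_self, one_mul]
  have := momentConst_ne_zero n
  positivity

/-- Pairing `Q_d + Σ_{j<d} α_j Q_j` with `Q_k` isolates the coefficient of `Q_k`. -/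
theorem momentFunctional_expansion_mul_Qpoly (α : ℕ → ℝ) (d k : ℕ) :
    momentFunctional ((Qpoly d + ∑ j ∈ Finset.range d, C (α j) * Qpoly j) * Qpoly k) =
      (if k = d then 1 else if k < d then α k else 0) *
        momentFunctional (Qpoly k * Qpoly k) := by
  have hterm (j : ℕ) : momentFunctional (C (α j) * Qpoly j * Qpoly k) =
      if k = j then α k * momentFunctional (Qpoly k * Qpoly k) else 0 := by
    rw [mul_assoc, momentFunctional_C_mul]
    split_ifs with h
    · rw [h]
    · rw [momentFunctional_Qpoly_mul_Qpoly_of_ne h, mul_zero]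
  rw [add_mul, map_add, Finset.sum_mul, map_sum, Finset.sum_congr rfl fun j _ => hterm j,
    Finset.sum_ite_eq]
  by_cases h : k = d
  · subst h; simp
  · by_cases h' : k < d <;>
      simp [h, h', momentFunctional_Qpoly_mul_Qpoly_of_ne h]

/-- Let `Q` be the unique monic minimal-degree polynomial with
`bᵀQ(A) = 0`, `d := deg Q`, and suppose the tall-tree order conditions of order `p` hold.
Writing `Q = Q_d + Σ_{j<d} α_j Q_j` in the basis of orthogonal polynomials, the coefficients
satisfy `α_j = 0` for `j ≤ p − d − 1`. -/
theorem Q_orthogonality {s : ℕ} (A : Matrix (Fin s) (Fin s) ℝ) (b : Fin s → ℝ)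
    (p : ℕ) (Q : Polynomial ℝ) (hQ : QProp A b Q) (d : ℕ) (hd : d = Q.natDegree)
    (horder : ∀ j : ℕ, j < p → b ⬝ᵥ (A ^ j).mulVec (ones s) = 1 / (Nat.factorial (j + 1)))
    (α : ℕ → ℝ)
    (hexp : Q = Qpoly d + ∑ j ∈ Finset.range d, C (α j) * Qpoly j) :
    ∀ j : ℕ, (j : ℤ) ≤ (p : ℤ) - d - 1 → α j = 0 := by
  have hpair (k : ℕ) (hk : d + k < p) : momentFunctional (Q * Qpoly k) = 0 := by
    have hdeg : (Q * Qpoly k).natDegree < p :=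
      natDegree_mul_le.trans_lt (by have := natDegree_Qpoly_le k; omega)
    rw [← dotProduct_aeval_mulVec_ones horder hdeg, map_mul, dotProduct_mulVec,
      ← vecMul_vecMul, hQ.2.1, zero_vecMul, zero_dotProduct]
  rw [hexp] at hpair
  simp only [momentFunctional_expansion_mul_Qpoly, mul_eq_zero,
    momentFunctional_Qpoly_mul_self_ne_zero, or_false] at hpair
  intro j hj
  have hlt : j < d := by
    by_contra h
    simpa using hpair d (by omega)
  simpa [hlt, hlt.ne] using hpair j (by omega)

end
end
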